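/- arXiv:2603.05416 — 5 statements merged into one kernel-verified Lean document; each statement's English description precedes it below -/
import Mathlib

section
/- Suppose |F| ≥ 3 or n ≥ 4. If A_1, A_2 are point-hyperplane anti-flags with A_1 ~_1 A_2, then the set {A_1, A_2}^{~_4} is a minimal element of the poset (𝔛, ⊆) (no member of 𝔛 is a proper subset of it) and is not a maximal element of (𝔛, ⊆) (some member of 𝔛 properly contains it). -/
/-- A point-hyperplane anti-flag of `PG(n-1,F)`: a pair `(p, H)` where `p` is a point
(1-dimensional subspace of `F^n`), `H` is a hyperplane ((n-1)-dimensional subspace),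
and `p` is not contained in `H`. -/
structure AntiFlag (F : Type*) [Field F] (n : ℕ) where
  pt : Submodule F (Fin n → F)
  hyp : Submodule F (Fin n → F)
  pt_rank : Module.finrank F pt = 1
  hyp_rank : Module.finrank F hyp = n - 1
  not_incident : ¬ pt ≤ hyp

variable {F : Type*} [Field F] {n : ℕ}

/-- `A ~₁ B` : for some `j`, `p_j ⊆ H_{3-j}` and `p_{3-j} ⊄ H_j`. -/
def adj1 (A B : AntiFlag F n) : Prop :=
  A ≠ B ∧ ((A.pt ≤ B.hyp ∧ ¬ B.pt ≤ A.hyp) ∨ (B.pt ≤ A.hyp ∧ ¬ A.pt ≤ B.hyp))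

/-- `A ~₂ B` : `p_1 ⊆ H_2` and `p_2 ⊆ H_1`. -/
def adj2 (A B : AntiFlag F n) : Prop :=
  A ≠ B ∧ A.pt ≤ B.hyp ∧ B.pt ≤ A.hyp

/-- `A ~₃ B` : `p_1 = p_2` or `H_1 = H_2`. -/
def adj3 (A B : AntiFlag F n) : Prop :=
  A ≠ B ∧ (A.pt = B.pt ∨ A.hyp = B.hyp)

/-- `A ~₄ B` : `p_1 ≠ p_2`, `H_1 ≠ H_2`, `p_1 ⊄ H_2` and `p_2 ⊄ H_1`. -/
def adj4 (A B : AntiFlag F n) : Prop :=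
  A ≠ B ∧ A.pt ≠ B.pt ∧ A.hyp ≠ B.hyp ∧ ¬ A.pt ≤ B.hyp ∧ ¬ B.pt ≤ A.hyp

/-- `𝒳^{~ᵢ}` : the set of anti-flags `i`-adjacent to every anti-flag of `𝒳`. -/
def perpSet (adj : AntiFlag F n → AntiFlag F n → Prop) (X : Set (AntiFlag F n)) :
    Set (AntiFlag F n) := {B | ∀ A ∈ X, adj A B}


/-- The family `𝔛` of all sets `{B₁,B₂}^{~₄}` where `B₁ ≠ B₂` are not `4`-adjacent. -/
def famX (F : Type*) [Field F] (n : ℕ) : Set (Set (AntiFlag F n)) :=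
  {X | ∃ B1 B2 : AntiFlag F n, B1 ≠ B2 ∧ ¬ adj4 B1 B2 ∧ X = perpSet adj4 {B1, B2}}

section Avoidance

open Module

variable {V : Type*} [AddCommGroup V] [Module F V]

theorem notMem_span_singleton_of_apply_eq {g : Dual F V} {x y q : V} (hx : g x ≠ 0)
    (hxy : g x = g y) (hne : x ≠ y) (hxq : x ∈ Submodule.span F {q}) :
    y ∉ Submodule.span F {q} := by
  intro hyq
  obtain ⟨α, rfl⟩ := Submodule.mem_span_singleton.1 hxq
  obtain ⟨β, rfl⟩ := Submodule.mem_span_singleton.1 hyq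
  simp only [map_smul, smul_eq_mul, ne_eq, mul_eq_zero, not_or] at hx hxy
  exact hne (by rw [mul_right_cancel₀ hx.2 hxy])

theorem exists_apply_ne_zero_of_two {a b : Dual F V} {W : Submodule F V}
    (ha : ∃ x ∈ W, a x ≠ 0) (hb : ∃ x ∈ W, b x ≠ 0) : ∃ x ∈ W, a x ≠ 0 ∧ b x ≠ 0 := by
  obtain ⟨x, hxW, hx⟩ := ha
  obtain ⟨y, hyW, hy⟩ := hb
  by_cases h1 : b x = 0
  · by_cases h2 : a y = 0
    · exact ⟨x + y, W.add_mem hxW hyW, by simpa [h2], by simpa [h1]⟩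
    · exact ⟨y, hyW, h2, hy⟩
  · exact ⟨x, hxW, hx, h1⟩

theorem exists_eq_smul_of_forall_apply_eq_zero {a b : Dual F V}
    (h : ∀ x, a x = 0 → b x = 0) : ∃ c : F, b = c • a := by
  have : b ∈ Submodule.span F (Set.range fun _ : Unit => a) :=
    mem_span_of_iInf_ker_le_ker fun x hx => h x (by simpa using hx)
  rw [Set.range_const] at this
  obtain ⟨c, hc⟩ := Submodule.mem_span_singleton.1 this
  exact ⟨c, hc.symm⟩

theorem exists_eq_smul_add_smul_of_forall_apply_eq_zero {a b c : Dual F V}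
    (h : ∀ x, a x = 0 → b x = 0 → c x = 0) : ∃ r s : F, c = r • a + s • b := by
  have : c ∈ Submodule.span F (Set.range ![a, b]) :=
    mem_span_of_iInf_ker_le_ker fun x hx => by
      simp only [Submodule.mem_iInf, Fin.forall_fin_two] at hx
      exact h x hx.1 hx.2
  rw [Matrix.range_cons_cons_empty] at this
  obtain ⟨r, s, hc⟩ := Submodule.mem_span_pair.1 this
  exact ⟨r, s, hc.symm⟩

theorem exists_apply_ne_zero_of_three {a b c : Dual F V} (ha : a ≠ 0) (hb : b ≠ 0) (hc : c ≠ 0)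
    (h : (∃ s : F, s ≠ 0 ∧ s ≠ 1) ∨ c ≠ a + b) : ∃ x, a x ≠ 0 ∧ b x ≠ 0 ∧ c x ≠ 0 := by
  have two : ∀ {f g : Dual F V}, f ≠ 0 → g ≠ 0 → ∃ x, f x ≠ 0 ∧ g x ≠ 0 := fun hf hg => by
    obtain ⟨x, hx⟩ := DFunLike.ne_iff.1 hf
    obtain ⟨y, hy⟩ := DFunLike.ne_iff.1 hg
    obtain ⟨z, -, hz⟩ := exists_apply_ne_zero_of_two (W := ⊤) ⟨x, trivial, hx⟩ ⟨y, trivial, hy⟩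
    exact ⟨z, hz⟩
  by_cases hker : ∃ y, a y = 0 ∧ b y = 0 ∧ c y ≠ 0
  · obtain ⟨y, hya, hyb, hyc⟩ := hker
    obtain ⟨x, hxa, hxb⟩ := two ha hb
    by_cases hxc : c x = 0
    · exact ⟨x + y, by simpa [hya], by simpa [hyb], by simpa [hxc]⟩
    · exact ⟨x, hxa, hxb, hxc⟩
  · push Not at hker
    obtain ⟨r, s, rfl⟩ := exists_eq_smul_add_smul_of_forall_apply_eq_zero hker
    by_cases hab : ∃ u, a u = 0 ∧ b u ≠ 0
    · by_cases hba : ∃ v, b v = 0 ∧ a v ≠ 0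
      · obtain ⟨u, hua, hub⟩ := hab
        obtain ⟨v, hvb, hva⟩ := hba
        obtain ⟨t, ht, hrt⟩ : ∃ t : F, t ≠ 0 ∧ r + s * t ≠ 0 := by
          by_contra! hcon
          have h1 := hcon 1 one_ne_zero
          rw [mul_one] at h1
          rcases h with ⟨t, ht0, ht1⟩ | hne
          · have h2 := hcon t ht0
            have hs : s = 0 := by
              have : s * (t - 1) = 0 := by linear_combination h2 - h1
              exact (mul_eq_zero.1 this).resolve_right (sub_ne_zero.2 ht1)
            have hr : r = 0 := by simpa [hs] using h1
            simp [hs, hr] at hc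
          · have hs : s ≠ 0 := by
              rintro rfl
              have hr : r = 0 := by simpa using h1
              simp [hr] at hc
            by_cases hs1 : s = 1
            · subst hs1
              by_cases hr1 : r = 1
              · subst hr1
                simp at hne
              · have h2 := hcon (-r) (by rintro h0; rw [neg_eq_zero] at h0; simp [h0] at h1)
                have h3 := hcon r (by rintro h0; simp [h0] at h1)
                have h4 : r ≠ 0 := by rintro h0; simp [h0] at h1
                have h5 : r = -1 := by linear_combination h1
                have h6 : (1 : F) + 1 = 0 := by linear_combination -h3 + 2 * h5
                exact hr1 (by linear_combination h5 - h6)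
            · have h2 := hcon s hs
              have : s * (s - 1) = 0 := by linear_combination h2 - h1
              rcases mul_eq_zero.1 this with h0 | h0
              · exact hs h0
              · exact hs1 (by linear_combination h0)
        refine ⟨(a v)⁻¹ • v + (t * (b u)⁻¹) • u, ?_, ?_, ?_⟩
        · simp [hua, hva]
        · simp [hvb, hub, ht]
        · simpa [hua, hva, hvb, hub] using hrt
      · push Not at hba
        obtain ⟨d, rfl⟩ := exists_eq_smul_of_forall_apply_eq_zero hba
        obtain ⟨x, hx, hxc⟩ := two ha hc
        refine ⟨x, hx, fun h0 => hx ?_, hxc⟩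
        simp [h0]
    · push Not at hab
      obtain ⟨d, rfl⟩ := exists_eq_smul_of_forall_apply_eq_zero hab
      obtain ⟨x, hx, hxc⟩ := two hb hc
      refine ⟨x, fun h0 => hx ?_, hx, hxc⟩
      simp [h0]

variable [FiniteDimensional F V]

theorem exists_notMem_span_singleton (hdim : 3 ≤ finrank F V)
    (hcard : (∃ s : F, s ≠ 0 ∧ s ≠ 1) ∨ 4 ≤ finrank F V) (g₁ g₂ g₃ : Dual F V) {x₀ : V}
    (h₂ : g₂ x₀ ≠ 0) (h₃ : g₃ x₀ ≠ 0) (q : V) :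
    ∃ x, g₁ x = g₁ x₀ ∧ g₂ x = g₂ x₀ ∧ g₃ x ≠ 0 ∧ x ∉ Submodule.span F {q} := by
  suffices ∃ y, g₁ y = g₁ x₀ ∧ g₂ y = g₂ x₀ ∧ g₃ y ≠ 0 ∧ x₀ ≠ y by
    obtain ⟨y, hy₁, hy₂, hy₃, hne⟩ := this
    by_cases hx : x₀ ∈ Submodule.span F {q}
    · exact ⟨y, hy₁, hy₂, hy₃, notMem_span_singleton_of_apply_eq h₂ hy₂.symm hne hx⟩
    · exact ⟨x₀, rfl, rfl, h₃, hx⟩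
  let φ : V →ₗ[F] F × F × F := g₁.prod (g₂.prod g₃)
  by_cases hker : LinearMap.ker φ = ⊥
  · have hle : finrank F V ≤ 3 := by
      have := LinearMap.finrank_le_finrank_of_injective (LinearMap.ker_eq_bot.1 hker)
      simpa using this
    obtain ⟨s, hs0, hs1⟩ := hcard.resolve_right (by omega)
    have hsurj : Function.Surjective φ :=
      (LinearMap.injective_iff_surjective_of_finrank_eq_finrank
        (by simp; omega)).1 (LinearMap.ker_eq_bot.1 hker)
    obtain ⟨y, hy⟩ := hsurj (g₁ x₀, g₂ x₀, s * g₃ x₀)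
    simp only [φ, LinearMap.prod_apply, Function.prod_apply, Prod.mk.injEq] at hy
    refine ⟨y, hy.1, hy.2.1, ?_, ?_⟩
    · rw [hy.2.2]; exact mul_ne_zero hs0 h₃
    · rintro rfl
      exact hs1 (mul_right_cancel₀ h₃ (by rw [one_mul]; exact hy.2.2.symm))
  · obtain ⟨z, hz, hz0⟩ := Submodule.exists_mem_ne_zero_of_ne_bot hker
    simp only [φ, LinearMap.mem_ker, LinearMap.prod_apply, Function.prod_apply,
      Prod.mk_eq_zero] at hz
    exact ⟨x₀ + z, by simp [hz.1], by simp [hz.2.1], by simpa [hz.2.2] using h₃,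
      by simpa using hz0⟩

theorem exists_notMem_span_singleton_pair (hdim : 3 ≤ finrank F V)
    (hcard : (∃ s : F, s ≠ 0 ∧ s ≠ 1) ∨ 4 ≤ finrank F V) (g₁ g₂ : Dual F V) {x₀ : V}
    (h₂ : g₂ x₀ ≠ 0) (q q' : V) :
    ∃ x, g₁ x = g₁ x₀ ∧ g₂ x = g₂ x₀ ∧ x ∉ Submodule.span F {q} ∧ x ∉ Submodule.span F {q'} := by
  obtain ⟨z, hz, hz0⟩ := Submodule.exists_mem_ne_zero_of_ne_bot
    (LinearMap.ker_ne_bot_of_finrank_lt (f := g₁.prod g₂) (by simp; omega))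
  simp only [LinearMap.mem_ker, LinearMap.prod_apply, Function.prod_apply,
    Prod.mk_eq_zero] at hz
  obtain ⟨w, hw, hw0, hwz⟩ : ∃ w, (g₁ w = 0 ∧ g₂ w = 0) ∧ w ≠ 0 ∧ w ≠ z := by
    rcases hcard with ⟨s, hs0, hs1⟩ | hdim4
    · refine ⟨s • z, by simp [hz], smul_ne_zero hs0 hz0, fun h => hs1 ?_⟩
      exact smul_left_injective F hz0 (by simpa using h)
    · obtain ⟨g, hg⟩ : ∃ g : Dual F V, g z ≠ 0 := by
        by_contra! hcon
        exact hz0 ((forall_dual_apply_eq_zero_iff F z).1 hcon)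
      obtain ⟨w, hw, hw0⟩ := Submodule.exists_mem_ne_zero_of_ne_bot
        (LinearMap.ker_ne_bot_of_finrank_lt (f := g₁.prod (g₂.prod g)) (by simp; omega))
      simp only [LinearMap.mem_ker, LinearMap.prod_apply, Function.prod_apply,
        Prod.mk_eq_zero] at hw
      exact ⟨w, ⟨hw.1, hw.2.1⟩, hw0, by rintro rfl; exact hg hw.2.2⟩
  have hxz : g₂ (x₀ + z) = g₂ x₀ := by simp [hz]
  have hxw : g₂ (x₀ + w) = g₂ x₀ := by simp [hw]
  have key : ∀ r : V,
      (x₀ ∈ Submodule.span F {r} → x₀ + z ∉ Submodule.span F {r}) ∧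
      (x₀ ∈ Submodule.span F {r} → x₀ + w ∉ Submodule.span F {r}) ∧
      (x₀ + z ∈ Submodule.span F {r} → x₀ + w ∉ Submodule.span F {r}) := fun r =>
    ⟨notMem_span_singleton_of_apply_eq h₂ hxz.symm (by simpa using hz0),
     notMem_span_singleton_of_apply_eq h₂ hxw.symm (by simpa using hw0),
     notMem_span_singleton_of_apply_eq (hxz ▸ h₂) (hxz.trans hxw.symm)
      (by simpa using hwz.symm)⟩
  obtain ⟨a1, a2, a3⟩ := key q
  obtain ⟨b1, b2, b3⟩ := key q'
  by_contra! hcon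
  have c1 := hcon x₀ rfl rfl
  have c2 := hcon (x₀ + z) (by simp [hz]) hxz
  have c3 := hcon (x₀ + w) (by simp [hw]) hxw
  by_cases m1 : x₀ ∈ Submodule.span F {q}
  · exact b3 (c2 (a1 m1)) (c3 (a2 m1))
  · by_cases m2 : x₀ + z ∈ Submodule.span F {q}
    · exact b2 (c1 m1) (c3 (a3 m2))
    · exact b1 (c1 m1) (c2 m2)

theorem exists_dual_notMem_span_singleton (hdim : 3 ≤ finrank F V)
    (hcard : (∃ s : F, s ≠ 0 ∧ s ≠ 1) ∨ 4 ≤ finrank F V) {p q₁ q₂ : V} (hp : p ≠ 0)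
    (hq₁ : q₁ ≠ 0) (hq₂ : q₂ ≠ 0) (h : (∃ s : F, s ≠ 0 ∧ s ≠ 1) ∨ p ≠ q₁ + q₂)
    (k : Dual F V) :
    ∃ f : Dual F V, f q₁ ≠ 0 ∧ f q₂ ≠ 0 ∧ f p ≠ 0 ∧ f ∉ Submodule.span F {k} := by
  have ev : ∀ {x : V}, x ≠ 0 → evalEquiv F V x ≠ 0 := fun hx =>
    (LinearEquiv.map_ne_zero_iff _).2 hx
  obtain ⟨f₀, h₁, h₂, h₃⟩ := exists_apply_ne_zero_of_three (ev hq₁) (ev hq₂) (ev hp)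
    (h.imp_right fun hne h0 => hne ((evalEquiv F V).injective (by rw [h0, map_add])))
  obtain ⟨f, hf₁, hf₂, hf₃, hf⟩ := exists_notMem_span_singleton
    (by rwa [Subspace.dual_finrank_eq]) (by rwa [Subspace.dual_finrank_eq])
    (evalEquiv F V q₁) (evalEquiv F V q₂) (evalEquiv F V p) h₂ h₃ k
  refine ⟨f, ?_, ?_, hf₃, hf⟩
  · rw [← hf₁] at h₁; exact h₁
  · rw [← hf₂] at h₂; exact h₂

private theorem exists_flag_of_apply_eq_zero (hdim : 3 ≤ finrank F V)
    (hcard : (∃ s : F, s ≠ 0 ∧ s ≠ 1) ∨ 4 ≤ finrank F V) {q₁ q₂ : V} {k₁ k₂ h : Dual F V}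
    (hk₁ : k₁ q₁ ≠ 0) (hk₂ : k₂ q₂ ≠ 0) (hk : k₁ q₂ = 0)
    (hu : ∃ u, h u = 0 ∧ k₁ u ≠ 0) (hv : ∃ v, h v = 0 ∧ k₂ v ≠ 0) :
    ∃ (p : V) (f : Dual F V), h p = 0 ∧ k₁ p ≠ 0 ∧ k₂ p ≠ 0 ∧
      p ∉ Submodule.span F {q₁} ∧ p ∉ Submodule.span F {q₂} ∧
      f q₁ ≠ 0 ∧ f q₂ ≠ 0 ∧ f p ≠ 0 ∧
      f ∉ Submodule.span F {k₁} ∧ f ∉ Submodule.span F {k₂} := by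
  have hq₁ : q₁ ≠ 0 := by rintro rfl; simp at hk₁
  have hq₂ : q₂ ≠ 0 := by rintro rfl; simp at hk₂
  have notMem : ∀ {k : Dual F V} {x q : V}, k x ≠ 0 → k q = 0 → x ∉ Submodule.span F {q} := by
    intro k x q hx hq hmem
    obtain ⟨c, rfl⟩ := Submodule.mem_span_singleton.1 hmem
    simp [hq] at hx
  obtain ⟨x₀, hx₀, hx₁, hx₂⟩ := exists_apply_ne_zero_of_two (W := LinearMap.ker h) hu hv
  rw [LinearMap.mem_ker] at hx₀
  obtain ⟨p, hp, hp₁, hp₂, hpq₁, hpne⟩ : ∃ p, h p = 0 ∧ k₁ p ≠ 0 ∧ k₂ p ≠ 0 ∧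
      p ∉ Submodule.span F {q₁} ∧ ((∃ s : F, s ≠ 0 ∧ s ≠ 1) ∨ p ≠ q₁ + q₂) := by
    by_cases hkq : k₂ q₁ = 0
    · obtain ⟨p, hp, hp₁, hp₂, hpq⟩ :=
        exists_notMem_span_singleton hdim hcard h k₁ k₂ hx₁ hx₂ (q₁ + q₂)
      refine ⟨p, hp.trans hx₀, hp₁ ▸ hx₁, hp₂, notMem hp₂ hkq, Or.inr ?_⟩
      rintro rfl
      exact hpq (Submodule.mem_span_singleton_self _)
    · obtain ⟨p, hp, hp₁, hp₂, hpq⟩ :=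
        exists_notMem_span_singleton hdim hcard h k₁ k₂ hx₁ hx₂ q₁
      refine ⟨p, hp.trans hx₀, hp₁ ▸ hx₁, hp₂, hpq, ?_⟩
      by_contra! hcon
      obtain ⟨hF, rfl⟩ := hcon
      rw [map_add, hF _ hkq, hF _ hk₂] at hp₂
      by_cases h2 : (-1 : F) = 1
      · exact hp₂ (by linear_combination -h2)
      · exact h2 (hF _ (by simp))
  have hp0 : p ≠ 0 := by rintro rfl; simp at hp₁
  obtain ⟨f, hf₁, hf₂, hf₃, hf⟩ := exists_dual_notMem_span_singleton hdim hcard hp0 hq₁ hq₂ hpne k₂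
  refine ⟨p, f, hp, hp₁, hp₂, hpq₁, notMem hp₁ hk, hf₁, hf₂, hf₃, fun hmem => ?_, hf⟩
  obtain ⟨c, rfl⟩ := Submodule.mem_span_singleton.1 hmem
  simp [hk] at hf₂

theorem exists_flag_of_not_adj (hdim : 3 ≤ finrank F V)
    (hcard : (∃ s : F, s ≠ 0 ∧ s ≠ 1) ∨ 4 ≤ finrank F V) {q₁ q₂ : V} {k₁ k₂ h : Dual F V}
    (hk₁ : k₁ q₁ ≠ 0) (hk₂ : k₂ q₂ ≠ 0)
    (hadj : (∃ c : F, q₁ = c • q₂) ∨ (∃ c : F, k₁ = c • k₂) ∨ k₁ q₂ = 0 ∨ k₂ q₁ = 0)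
    (hu : ∃ u, h u = 0 ∧ k₁ u ≠ 0) (hv : ∃ v, h v = 0 ∧ k₂ v ≠ 0) :
    ∃ (p : V) (f : Dual F V), h p = 0 ∧ k₁ p ≠ 0 ∧ k₂ p ≠ 0 ∧
      p ∉ Submodule.span F {q₁} ∧ p ∉ Submodule.span F {q₂} ∧
      f q₁ ≠ 0 ∧ f q₂ ≠ 0 ∧ f p ≠ 0 ∧
      f ∉ Submodule.span F {k₁} ∧ f ∉ Submodule.span F {k₂} := by
  have hq₁ : q₁ ≠ 0 := by rintro rfl; simp at hk₁
  have hq₂ : q₂ ≠ 0 := by rintro rfl; simp at hk₂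
  rcases hadj with ⟨c, rfl⟩ | ⟨c, rfl⟩ | hk | hk
  · have hc : c ≠ 0 := by rintro rfl; simp at hq₁
    obtain ⟨x₀, hx₀, hx₁, hx₂⟩ := exists_apply_ne_zero_of_two (W := LinearMap.ker h) hu hv
    obtain ⟨p, hp, hp₁, hp₂, hpq⟩ :=
      exists_notMem_span_singleton hdim hcard h k₁ k₂ hx₁ hx₂ q₂
    have hp0 : p ≠ 0 := by rintro rfl; simp at hp₂
    have ev : ∀ {x : V}, x ≠ 0 → ∃ f ∈ (⊤ : Submodule F (Dual F V)), evalEquiv F V x f ≠ 0 := by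
      intro x hx
      by_contra! hcon
      exact hx ((forall_dual_apply_eq_zero_iff F x).1 fun φ => hcon φ trivial)
    obtain ⟨f₀, -, hf₀, hf₀'⟩ := exists_apply_ne_zero_of_two (ev hp0) (ev hq₂)
    obtain ⟨f, hf₁, hf₂, hf, hf'⟩ := exists_notMem_span_singleton_pair
      (by rwa [Subspace.dual_finrank_eq]) (by rwa [Subspace.dual_finrank_eq])
      (evalEquiv F V p) (evalEquiv F V q₂) hf₀' k₁ k₂
    rw [← hf₁] at hf₀
    rw [← hf₂] at hf₀'
    refine ⟨p, f, hp.trans hx₀, hp₁ ▸ hx₁, hp₂, ?_, hpq, ?_, hf₀', hf₀, hf, hf'⟩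
    · rwa [Submodule.span_singleton_smul_eq hc.isUnit]
    · rw [map_smul]; exact smul_ne_zero hc hf₀'
  · obtain ⟨v, hv, hvk⟩ := hv
    have hc : c ≠ 0 := by rintro rfl; simp at hk₁
    obtain ⟨p, hp, hp₂, hpq₁, hpq₂⟩ :=
      exists_notMem_span_singleton_pair hdim hcard h k₂ hvk q₁ q₂
    have hkp : k₂ p ≠ 0 := hp₂ ▸ hvk
    have hp0 : p ≠ 0 := by rintro rfl; simp at hkp
    have hkq : k₂ q₁ ≠ 0 := fun h0 => hk₁ (by simp [h0])
    obtain ⟨f, hf₁, hf₂, hf₃, hf⟩ := exists_dual_notMem_span_singleton hdim hcard hp0 hq₁ hq₂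
      (by
        by_contra! hcon
        obtain ⟨hF, rfl⟩ := hcon
        rw [map_add, hF _ hkq, hF _ hk₂] at hkp
        by_cases h2 : (-1 : F) = 1
        · exact hkp (by linear_combination -h2)
        · exact h2 (hF _ (by simp))) k₂
    refine ⟨p, f, hp.trans hv, ?_, hkp, hpq₁, hpq₂, hf₁, hf₂, hf₃, ?_, hf⟩
    · simp [hc, hkp]
    · rwa [Submodule.span_singleton_smul_eq hc.isUnit]
  · exact exists_flag_of_apply_eq_zero hdim hcard hk₁ hk₂ hk hu hv
  · obtain ⟨p, f, h1, h2, h3, h4, h5, h6, h7, h8, h9, h10⟩ :=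
      exists_flag_of_apply_eq_zero hdim hcard hk₂ hk₁ hk hv hu
    exact ⟨p, f, h1, h3, h2, h5, h4, h7, h6, h8, h10, h9⟩

end Avoidance

namespace AntiFlag

open Module

/-- The anti-flag whose point is spanned by `v` and whose hyperplane is the kernel of `k`. -/
def ofApplyNeZero (v : Fin n → F) (k : Dual F (Fin n → F)) (h : k v ≠ 0) : AntiFlag F n where
  pt := Submodule.span F {v}
  hyp := LinearMap.ker k
  pt_rank := finrank_span_singleton (by rintro rfl; simp at h)
  hyp_rank := by
    have := Dual.finrank_ker_add_one_of_ne_zero (f := k) (by rintro rfl; simp at h)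
    rw [finrank_fin_fun] at this
    omega
  not_incident := by simpa [Submodule.span_singleton_le_iff_mem] using h

theorem exists_eq_ofApplyNeZero (A : AntiFlag F n) :
    ∃ (v : Fin n → F) (k : Dual F (Fin n → F)) (h : k v ≠ 0), A = ofApplyNeZero v k h := by
  obtain ⟨pt, hyp, hpt, hhyp, hinc⟩ := A
  obtain ⟨v, hv0, hv⟩ := finrank_eq_one_iff'.1 hpt
  have hspan : pt = Submodule.span F {(v : Fin n → F)} := by
    refine le_antisymm (fun w hw => ?_) (by simp)
    obtain ⟨c, hc⟩ := hv ⟨w, hw⟩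
    exact Submodule.mem_span_singleton.2 ⟨c, congrArg Subtype.val hc⟩
  have hmem : (v : Fin n → F) ∉ hyp := by
    rwa [hspan, Submodule.span_singleton_le_iff_mem] at hinc
  obtain ⟨k, hk, hle⟩ := Submodule.exists_le_ker_of_notMem hmem
  have hker : hyp = LinearMap.ker k := by
    refine Submodule.eq_of_le_of_finrank_eq hle ?_
    rw [hhyp]
    exact (ofApplyNeZero _ k hk).hyp_rank.symm
  exact ⟨v, k, hk, by simp only [ofApplyNeZero, hspan, hker]⟩

theorem span_eq_span_iff {V : Type*} [AddCommGroup V] [Module F V] {p q : V} (hp : p ≠ 0) :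
    Submodule.span F {p} = Submodule.span F {q} ↔ p ∈ Submodule.span F {q} := by
  refine ⟨fun h => h ▸ Submodule.mem_span_singleton_self p, fun h => ?_⟩
  obtain ⟨c, rfl⟩ := Submodule.mem_span_singleton.1 h
  have hc : c ≠ 0 := by rintro rfl; simp at hp
  exact Submodule.span_singleton_smul_eq hc.isUnit q

theorem ker_eq_ker_iff {V : Type*} [AddCommGroup V] [Module F V] {f k : Dual F V} (hf : f ≠ 0) :
    LinearMap.ker f = LinearMap.ker k ↔ f ∈ Submodule.span F {k} := by
  refine ⟨fun h => ?_, fun h => ?_⟩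
  · obtain ⟨c, rfl⟩ := exists_eq_smul_of_forall_apply_eq_zero (a := k) (b := f)
      fun x hx => by rwa [← LinearMap.mem_ker, h, LinearMap.mem_ker]
    exact Submodule.mem_span_singleton.2 ⟨c, rfl⟩
  · obtain ⟨c, rfl⟩ := Submodule.mem_span_singleton.1 h
    have hc : c ≠ 0 := by rintro rfl; simp at hf
    exact LinearMap.ker_smul _ _ hc

theorem adj4_ofApplyNeZero_iff {q p : Fin n → F} {k f : Dual F (Fin n → F)} (hk : k q ≠ 0)
    (hf : f p ≠ 0) :
    adj4 (ofApplyNeZero q k hk) (ofApplyNeZero p f hf) ↔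
      p ∉ Submodule.span F {q} ∧ f ∉ Submodule.span F {k} ∧ f q ≠ 0 ∧ k p ≠ 0 := by
  have hp0 : p ≠ 0 := by rintro rfl; simp at hf
  have hf0 : f ≠ 0 := by rintro rfl; simp at hf
  rw [← span_eq_span_iff hp0, ← ker_eq_ker_iff hf0]
  simp only [adj4, ofApplyNeZero, Submodule.span_singleton_le_iff_mem, LinearMap.mem_ker, ne_eq,
    eq_comm (a := Submodule.span F {q}), eq_comm (a := LinearMap.ker k)]
  refine ⟨fun h => h.2, fun h => ⟨fun he => h.1 ?_, h⟩⟩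
  exact (congrArg AntiFlag.pt he).symm

end AntiFlag

theorem perpSet_pair_comm (A B : AntiFlag F n) :
    perpSet adj4 {A, B} = perpSet adj4 {B, A} := by
  rw [Set.pair_comm]

theorem mem_perpSet_pair {A B C : AntiFlag F n} :
    C ∈ perpSet adj4 {A, B} ↔ adj4 A C ∧ adj4 B C := by
  simp [perpSet]

section Main

open Module AntiFlag

variable {q₁ q₂ a₁ a₂ : Fin n → F} {k₁ k₂ h₁ h₂ : Dual F (Fin n → F)}

theorem not_adj4_ofApplyNeZero {hk₁ : k₁ q₁ ≠ 0} {hk₂ : k₂ q₂ ≠ 0}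
    (h : ¬ adj4 (ofApplyNeZero q₁ k₁ hk₁) (ofApplyNeZero q₂ k₂ hk₂)) :
    (∃ c : F, q₂ = c • q₁) ∨ (∃ c : F, k₂ = c • k₁) ∨ k₂ q₁ = 0 ∨ k₁ q₂ = 0 := by
  rw [adj4_ofApplyNeZero_iff] at h
  by_contra! hcon
  refine h ⟨fun hm => ?_, fun hm => ?_, hcon.2.2⟩
  · obtain ⟨c, hc⟩ := Submodule.mem_span_singleton.1 hm
    exact hcon.1 c hc.symm
  · obtain ⟨c, hc⟩ := Submodule.mem_span_singleton.1 hm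
    exact hcon.2.1 c hc.symm

/-- If the common `4`-neighbours of a non-`4`-adjacent pair all have their point off the kernel of
`h`, then that kernel is one of the hyperplanes of the pair. -/
theorem ker_eq_or_ker_eq (hn : 3 ≤ n) (hcard : (∃ s : F, s ≠ 0 ∧ s ≠ 1) ∨ 4 ≤ n)
    (hk₁ : k₁ q₁ ≠ 0) (hk₂ : k₂ q₂ ≠ 0)
    (hadj : ¬ adj4 (ofApplyNeZero q₁ k₁ hk₁) (ofApplyNeZero q₂ k₂ hk₂))
    {h : Dual F (Fin n → F)}
    (hperp : ∀ p f, (hf : f p ≠ 0) → ofApplyNeZero p f hf ∈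
      perpSet adj4 {ofApplyNeZero q₁ k₁ hk₁, ofApplyNeZero q₂ k₂ hk₂} → h p ≠ 0) :
    LinearMap.ker k₁ = LinearMap.ker h ∨ LinearMap.ker k₂ = LinearMap.ker h := by
  have hk₁0 : k₁ ≠ 0 := by rintro rfl; simp at hk₁
  have hk₂0 : k₂ ≠ 0 := by rintro rfl; simp at hk₂
  have hker : ∀ {k : Dual F (Fin n → F)}, k ≠ 0 → LinearMap.ker k ≠ LinearMap.ker h →
      ∃ u, h u = 0 ∧ k u ≠ 0 := by
    intro k hk0 hne
    by_contra! hcon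
    obtain ⟨c, rfl⟩ := exists_eq_smul_of_forall_apply_eq_zero hcon
    exact hne ((ker_eq_ker_iff hk0).2 (Submodule.mem_span_singleton.2 ⟨c, rfl⟩))
  by_contra! hcon
  obtain ⟨p, f, hp, hp₁, hp₂, hpq₁, hpq₂, hf₁, hf₂, hfp, hfk₁, hfk₂⟩ :=
    exists_flag_of_not_adj (by rwa [finrank_fin_fun]) (by rwa [finrank_fin_fun]) hk₂ hk₁
      (not_adj4_ofApplyNeZero hadj) (hker hk₂0 hcon.2) (hker hk₁0 hcon.1)
  refine hperp p f hfp ?_ hp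
  rw [mem_perpSet_pair, adj4_ofApplyNeZero_iff, adj4_ofApplyNeZero_iff]
  exact ⟨⟨hpq₂, hfk₂, hf₂, hp₂⟩, hpq₁, hfk₁, hf₁, hp₁⟩

/-- If the common `4`-neighbours of a non-`4`-adjacent pair all have their hyperplane off the
point spanned by `a`, then that point is one of the points of the pair. -/
theorem span_eq_or_span_eq (hn : 3 ≤ n) (hcard : (∃ s : F, s ≠ 0 ∧ s ≠ 1) ∨ 4 ≤ n)
    (hk₁ : k₁ q₁ ≠ 0) (hk₂ : k₂ q₂ ≠ 0)
    (hadj : ¬ adj4 (ofApplyNeZero q₁ k₁ hk₁) (ofApplyNeZero q₂ k₂ hk₂))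
    {a : Fin n → F}
    (hperp : ∀ p f, (hf : f p ≠ 0) → ofApplyNeZero p f hf ∈
      perpSet adj4 {ofApplyNeZero q₁ k₁ hk₁, ofApplyNeZero q₂ k₂ hk₂} → f a ≠ 0) :
    Submodule.span F {q₁} = Submodule.span F {a} ∨
      Submodule.span F {q₂} = Submodule.span F {a} := by
  have hq₁0 : q₁ ≠ 0 := by rintro rfl; simp at hk₁
  have hq₂0 : q₂ ≠ 0 := by rintro rfl; simp at hk₂
  let e := evalEquiv F (Fin n → F)
  have hspan : ∀ {q : Fin n → F}, q ≠ 0 → Submodule.span F {q} ≠ Submodule.span F {a} →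
      ∃ g : Dual F (Fin n → F), e a g = 0 ∧ e q g ≠ 0 := by
    intro q hq0 hne
    rw [ne_eq, span_eq_span_iff hq0] at hne
    obtain ⟨g, hg, hle⟩ := Submodule.exists_le_ker_of_notMem hne
    exact ⟨g, LinearMap.mem_ker.1 (hle (Submodule.mem_span_singleton_self a)), hg⟩
  by_contra! hcon
  obtain ⟨f, ξ, hf, hf₁, hf₂, hfk₁, hfk₂, hξ₁, hξ₂, hξf, hξq₁, hξq₂⟩ :=
    exists_flag_of_not_adj (q₁ := k₂) (q₂ := k₁) (k₁ := e q₂) (k₂ := e q₁) (h := e a)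
      (by rwa [Subspace.dual_finrank_eq, finrank_fin_fun])
      (by rwa [Subspace.dual_finrank_eq, finrank_fin_fun]) hk₂ hk₁
      (by
        rcases not_adj4_ofApplyNeZero hadj with ⟨c, rfl⟩ | hk | hk | hk
        · exact Or.inr (Or.inl ⟨c, map_smul e c q₁⟩)
        · exact Or.inl hk
        · exact Or.inr (Or.inr (Or.inr hk))
        · exact Or.inr (Or.inr (Or.inl hk)))
      (hspan hq₂0 hcon.2) (hspan hq₁0 hcon.1)
  obtain ⟨p, rfl⟩ := e.surjective ξ
  have hmem : ∀ {q : Fin n → F}, e p ∉ Submodule.span F {e q} → p ∉ Submodule.span F {q} := by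
    intro q hq hm
    obtain ⟨c, rfl⟩ := Submodule.mem_span_singleton.1 hm
    exact hq (Submodule.mem_span_singleton.2 ⟨c, (map_smul e c q).symm⟩)
  have hfp : f p ≠ 0 := hξf
  refine hperp p f hfp ?_ hf
  rw [mem_perpSet_pair, adj4_ofApplyNeZero_iff, adj4_ofApplyNeZero_iff]
  exact ⟨⟨hmem hξq₂, hfk₂, hf₂, hξ₂⟩, hmem hξq₁, hfk₁, hf₁, hξ₁⟩

private theorem minimal_and_not_maximal_of_apply_eq_zero (hn : 3 ≤ n)
    (hcard : (∃ s : F, s ≠ 0 ∧ s ≠ 1) ∨ 4 ≤ n) (ha₁ : h₁ a₁ ≠ 0) (ha₂ : h₂ a₂ ≠ 0)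
    (h21 : h₂ a₁ = 0) (h12 : h₁ a₂ ≠ 0) :
    (∀ Y ∈ famX F n,
      ¬ Y ⊂ perpSet adj4 {ofApplyNeZero a₁ h₁ ha₁, ofApplyNeZero a₂ h₂ ha₂}) ∧
    (∃ Y ∈ famX F n,
      perpSet adj4 {ofApplyNeZero a₁ h₁ ha₁, ofApplyNeZero a₂ h₂ ha₂} ⊂ Y) := by
  have ha₁0 : a₁ ≠ 0 := by rintro rfl; simp at ha₁
  have ha₂0 : a₂ ≠ 0 := by rintro rfl; simp at ha₂
  have ha : Submodule.span F {a₁} ≠ Submodule.span F {a₂} := by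
    rw [ne_eq, span_eq_span_iff ha₁0]
    intro hm
    obtain ⟨c, rfl⟩ := Submodule.mem_span_singleton.1 hm
    simp only [map_smul, smul_eq_mul, mul_eq_zero, ha₂, or_false] at h21
    simp [h21] at ha₁0
  have hh : LinearMap.ker h₁ ≠ LinearMap.ker h₂ := fun he =>
    ha₁ (LinearMap.mem_ker.1 (he ▸ LinearMap.mem_ker.2 h21))
  constructor
  · rintro Y ⟨B₁, B₂, -, hadj, rfl⟩ hss
    obtain ⟨q₁, k₁, hk₁, rfl⟩ := B₁.exists_eq_ofApplyNeZero
    obtain ⟨q₂, k₂, hk₂, rfl⟩ := B₂.exists_eq_ofApplyNeZero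
    have hsub : ∀ p f, (hf : f p ≠ 0) → ofApplyNeZero p f hf ∈
        perpSet adj4 {ofApplyNeZero q₁ k₁ hk₁, ofApplyNeZero q₂ k₂ hk₂} →
        (h₁ p ≠ 0 ∧ h₂ p ≠ 0) ∧ f a₁ ≠ 0 ∧ f a₂ ≠ 0 := by
      intro p f hf hp
      have := hss.subset hp
      rw [mem_perpSet_pair, adj4_ofApplyNeZero_iff, adj4_ofApplyNeZero_iff] at this
      exact ⟨⟨this.1.2.2.2, this.2.2.2.2⟩, this.1.2.2.1, this.2.2.2.1⟩
    have e1 := ker_eq_or_ker_eq hn hcard hk₁ hk₂ hadj (fun p f hf hp => (hsub p f hf hp).1.1)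
    have e2 := ker_eq_or_ker_eq hn hcard hk₁ hk₂ hadj (fun p f hf hp => (hsub p f hf hp).1.2)
    have e3 := span_eq_or_span_eq hn hcard hk₁ hk₂ hadj (fun p f hf hp => (hsub p f hf hp).2.1)
    have e4 := span_eq_or_span_eq hn hcard hk₁ hk₂ hadj (fun p f hf hp => (hsub p f hf hp).2.2)
    have hinc : ∀ {q : Fin n → F} {k : Dual F (Fin n → F)}, k q ≠ 0 →
        Submodule.span F {q} = Submodule.span F {a₁} → LinearMap.ker k ≠ LinearMap.ker h₂ := by
      intro q k hk hq hker
      obtain ⟨c, rfl⟩ := Submodule.mem_span_singleton.1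
        (hq ▸ Submodule.mem_span_singleton_self q : q ∈ Submodule.span F {a₁})
      exact hk (LinearMap.mem_ker.1 (hker ▸ LinearMap.mem_ker.2 (by simp [h21])))
    have hcases : (LinearMap.ker k₁ = LinearMap.ker h₁ ∧ LinearMap.ker k₂ = LinearMap.ker h₂) ∨
        (LinearMap.ker k₁ = LinearMap.ker h₂ ∧ LinearMap.ker k₂ = LinearMap.ker h₁) := by
      rcases e1 with e1 | e1 <;> rcases e2 with e2 | e2
      · exact absurd (e1.symm.trans e2) hh
      · exact Or.inl ⟨e1, e2⟩
      · exact Or.inr ⟨e2, e1⟩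
      · exact absurd (e1.symm.trans e2) hh
    rcases hcases with ⟨l1, l2⟩ | ⟨l1, l2⟩
    · have m1 := e3.resolve_right fun hq => hinc hk₂ hq l2
      have m2 := e4.resolve_left fun hq => ha (m1.symm.trans hq)
      refine hss.ne ?_
      simp only [ofApplyNeZero, l1, l2, m1, m2]
    · have m1 := e3.resolve_left fun hq => hinc hk₁ hq l1
      have m2 := e4.resolve_right fun hq => ha (m1.symm.trans hq)
      refine hss.ne ?_
      rw [perpSet_pair_comm]
      simp only [ofApplyNeZero, l1, l2, m1, m2]
  · refine ⟨_, ⟨ofApplyNeZero a₁ h₁ ha₁, ofApplyNeZero a₂ h₁ h12,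
      fun he => ha (congrArg AntiFlag.pt he), fun hadj => hadj.2.2.1 rfl, rfl⟩, ?_⟩
    rw [Set.ssubset_iff_exists]
    constructor
    · intro C hC
      obtain ⟨p, f, hf, rfl⟩ := C.exists_eq_ofApplyNeZero
      rw [mem_perpSet_pair, adj4_ofApplyNeZero_iff, adj4_ofApplyNeZero_iff] at hC ⊢
      exact ⟨hC.1, hC.2.1, hC.1.2.1, hC.2.2.2.1, hC.1.2.2.2⟩
    · obtain ⟨x, hx, hx0⟩ := Submodule.exists_mem_ne_zero_of_ne_bot
        (LinearMap.ker_ne_bot_of_finrank_lt (f := h₁.prod h₂) (by simp; omega))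
      simp only [LinearMap.mem_ker, LinearMap.prod_apply, Function.prod_apply,
        Prod.mk_eq_zero] at hx
      have hp₁ : h₁ (a₁ + x) ≠ 0 := by simpa [hx.1] using ha₁
      have hp₂ : h₂ (a₁ + x) = 0 := by simp [h21, hx.2]
      have hp0 : a₁ + x ≠ 0 := by rintro h0; simp [h0] at hp₁
      have hpa₁ : a₁ + x ∉ Submodule.span F {a₁} :=
        notMem_span_singleton_of_apply_eq ha₁ (by simp [hx.1]) (by simpa using hx0)
          (Submodule.mem_span_singleton_self a₁)
      have hpa₂ : a₁ + x ∉ Submodule.span F {a₂} := by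
        rw [Submodule.mem_span_singleton]
        rintro ⟨c, hc⟩
        rw [← hc, map_smul, smul_eq_mul, mul_eq_zero, or_iff_left ha₂] at hp₂
        exact hp0 (by rw [← hc, hp₂, zero_smul])
      obtain ⟨f, hf₁, hf₂, hfp, hf⟩ := exists_dual_notMem_span_singleton
        (by rwa [finrank_fin_fun]) (by rwa [finrank_fin_fun]) hp0 ha₁0 ha₂0
        (Or.inr fun he => ha₂ (by rw [he, map_add, h21, zero_add] at hp₂; exact hp₂)) h₁
      refine ⟨ofApplyNeZero (a₁ + x) f hfp, ?_, ?_⟩ <;>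
        rw [mem_perpSet_pair, adj4_ofApplyNeZero_iff, adj4_ofApplyNeZero_iff]
      · exact ⟨⟨hpa₁, hf, hf₁, hp₁⟩, hpa₂, hf, hf₂, hp₁⟩
      · exact fun hC => hC.2.2.2.2 hp₂

end Main

theorem stmt6 (hn : 3 ≤ n) (hcard : 3 ≤ Cardinal.mk F ∨ 4 ≤ n)
    (A1 A2 : AntiFlag F n) (h : adj1 A1 A2) :
    (∀ Y ∈ famX F n, ¬ Y ⊂ perpSet adj4 {A1, A2}) ∧
    (∃ Y ∈ famX F n, perpSet adj4 {A1, A2} ⊂ Y) := by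
  have hF : (∃ s : F, s ≠ 0 ∧ s ≠ 1) ∨ 4 ≤ n :=
    hcard.imp_left fun h3 => Cardinal.exists_ne_ne_of_three_le h3 0 1
  obtain ⟨a₁, h₁, ha₁, rfl⟩ := A1.exists_eq_ofApplyNeZero
  obtain ⟨a₂, h₂, ha₂, rfl⟩ := A2.exists_eq_ofApplyNeZero
  obtain ⟨-, ⟨h21, h12⟩ | ⟨h12, h21⟩⟩ := h <;>
    simp only [AntiFlag.ofApplyNeZero, Submodule.span_singleton_le_iff_mem,
      LinearMap.mem_ker] at h12 h21
  · exact minimal_and_not_maximal_of_apply_eq_zero hn hF ha₁ ha₂ h21 h12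
  · rw [perpSet_pair_comm]
    exact minimal_and_not_maximal_of_apply_eq_zero hn hF ha₂ ha₁ h12 h21
end

section
/- Suppose |F| ≥ 3 or n ≥ 4. If A_1, A_2 are point-hyperplane anti-flags with A_1 ~_2 A_2, then the set {A_1, A_2}^{~_4} is both a minimal and a maximal element of the poset (𝔛, ⊆) (no member of 𝔛 is a proper subset of it and no member of 𝔛 properly contains it). -/
variable {F : Type*} [Field F] {n : ℕ}

open Module

section Avoidance

variable {K V : Type*} [Field K] [AddCommGroup V] [Module K V]

theorem exists_ne_zero_add_mul_ne_zero (hK : ∃ a : K, a ≠ 0 ∧ a ≠ 1) {x : K} (hx : x ≠ 0) (y : K) :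
    ∃ c : K, c ≠ 0 ∧ x + c * y ≠ 0 := by
  obtain ⟨a, ha0, ha1⟩ := hK
  by_cases h : x + y = 0
  · refine ⟨a, ha0, fun h' => ?_⟩
    have : (1 - a) * x = 0 := by linear_combination h' - a * h
    rcases mul_eq_zero.1 this with h1 | h1
    · exact ha1 (sub_eq_zero.1 h1).symm
    · exact hx h1
  · exact ⟨1, one_ne_zero, by simpa using h⟩

theorem add_notMem_span_singleton {f : Dual K V} {q k z : V} (hq : f q ≠ 0) (hk : f k = 0)
    (hk0 : k ≠ 0) (hqz : q ∈ Submodule.span K {z}) : q + k ∉ Submodule.span K {z} := by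
  intro h
  have hkz : k ∈ Submodule.span K {z} := by simpa using Submodule.sub_mem _ h hqz
  obtain ⟨c, rfl⟩ := Submodule.mem_span_singleton.1 hqz
  obtain ⟨d, rfl⟩ := Submodule.mem_span_singleton.1 hkz
  simp only [map_smul, smul_eq_mul, mul_eq_zero, ne_eq, not_or, smul_eq_zero] at hq hk hk0
  tauto

theorem notMem_span_singleton_of_apply {f : Dual K V} {q z : V} (hq : f q ≠ 0) (hz : f z = 0) :
    q ∉ Submodule.span K {z} := by
  intro h
  obtain ⟨c, rfl⟩ := Submodule.mem_span_singleton.1 h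
  simp [hz] at hq

theorem exists_ne_zero_forall_apply_eq_zero [FiniteDimensional K V] {m : ℕ} (f : Fin m → Dual K V)
    (hm : m < finrank K V) : ∃ k : V, k ≠ 0 ∧ ∀ i, f i k = 0 := by
  have h : (LinearMap.pi f).ker ≠ ⊥ := LinearMap.ker_ne_bot_of_finrank_lt (by simpa using hm)
  obtain ⟨k, hk, hk0⟩ := Submodule.exists_mem_ne_zero_of_ne_bot h
  exact ⟨k, hk0, fun i => congrFun (LinearMap.mem_ker.1 hk) i⟩

theorem exists_two_apply_ne_zero {f₁ f₂ : Dual K V} (h₁ : f₁ ≠ 0) (h₂ : f₂ ≠ 0) :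
    ∃ q, f₁ q ≠ 0 ∧ f₂ q ≠ 0 := by
  obtain ⟨x, hx⟩ := DFunLike.ne_iff.1 h₁
  obtain ⟨y, hy⟩ := DFunLike.ne_iff.1 h₂
  rw [LinearMap.zero_apply] at hx hy
  by_cases hx2 : f₂ x = 0
  · by_cases hy1 : f₁ y = 0
    · exact ⟨x + y, by simpa [hy1] using hx, by simpa [hx2] using hy⟩
    · exact ⟨y, hy1, hy⟩
  · exact ⟨x, hx, hx2⟩

theorem exists_three_apply_ne_zero {f₁ f₂ f₃ : Dual K V} (h₁ : f₁ ≠ 0) (h₂ : f₂ ≠ 0) (h₃ : f₃ ≠ 0)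
    (h : (∃ a : K, a ≠ 0 ∧ a ≠ 1) ∨ f₁ + f₂ + f₃ ≠ 0) :
    ∃ q, f₁ q ≠ 0 ∧ f₂ q ≠ 0 ∧ f₃ q ≠ 0 := by
  obtain ⟨q, hq1, hq2⟩ := exists_two_apply_ne_zero h₁ h₂
  by_cases hq3 : f₃ q = 0; swap
  · exact ⟨q, hq1, hq2, hq3⟩
  obtain ⟨k, hk1, hk3⟩ := exists_two_apply_ne_zero h₁ h₃
  by_cases hk2 : f₂ k = 0; swap
  · exact ⟨k, hk1, hk2, hk3⟩
  by_cases hK : ∃ a : K, a ≠ 0 ∧ a ≠ 1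
  · obtain ⟨c, hc, hc'⟩ := exists_ne_zero_add_mul_ne_zero hK hq1 (f₁ k)
    exact ⟨q + c • k, by simpa using hc', by simpa [hk2] using hq2, by simp [hq3, hc, hk3]⟩
  have hbool : ∀ x : K, x ≠ 0 → x = 1 := fun x hx => by
    by_contra hx'
    exact hK ⟨x, hx, hx'⟩
  have htwo : (1 : K) + 1 = 0 := by
    by_contra h2
    simpa using hbool _ h2
  obtain ⟨j, hj2, hj3⟩ := exists_two_apply_ne_zero h₂ h₃
  by_cases hj1 : f₁ j = 0; swap
  · exact ⟨j, hj1, hj2, hj3⟩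
  obtain ⟨m, hm⟩ := DFunLike.ne_iff.1 (h.resolve_left hK)
  simp only [LinearMap.add_apply, LinearMap.zero_apply] at hm
  by_cases m1 : f₁ m = 0
  · by_cases m2 : f₂ m = 0
    · exact ⟨m + q, by simpa [m1], by simpa [m2], by simpa [m1, m2, hq3] using hm⟩
    · by_cases m3 : f₃ m = 0
      · exact ⟨m + k, by simpa [m1], by simpa [hk2], by simpa [m3]⟩
      · rw [m1, hbool _ m2, hbool _ m3, zero_add] at hm
        exact absurd htwo hm
  · by_cases m2 : f₂ m = 0
    · by_cases m3 : f₃ m = 0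
      · exact ⟨m + j, by simpa [hj1], by simpa [m2], by simpa [m3]⟩
      · rw [m2, hbool _ m1, hbool _ m3, add_zero] at hm
        exact absurd htwo hm
    · by_cases m3 : f₃ m = 0
      · rw [m3, hbool _ m1, hbool _ m2, add_zero] at hm
        exact absurd htwo hm
      · exact ⟨m, m1, m2, m3⟩

theorem mem_span_singleton_of_ker_le_ker {f g : Dual K V}
    (h : LinearMap.ker f ≤ LinearMap.ker g) : g ∈ Submodule.span K {f} := by
  have hmem := mem_span_of_iInf_ker_le_ker (L := fun _ : Unit => f) (K := g) (by rwa [iInf_const])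
  rwa [Set.range_const] at hmem

theorem domRestrict_ker_ne_zero {f f₁ : Dual K V} (h₁ : f₁ ≠ 0) (hf : f ∉ Submodule.span K {f₁}) :
    f₁.domRestrict (LinearMap.ker f) ≠ 0 := by
  intro h
  have hmem := mem_span_singleton_of_ker_le_ker fun x hx => LinearMap.congr_fun h ⟨x, hx⟩
  obtain ⟨c, rfl⟩ := Submodule.mem_span_singleton.1 hmem
  have hc : c ≠ 0 := by
    rintro rfl
    simp at h₁
  exact hf (Submodule.mem_span_singleton.2 ⟨c⁻¹, inv_smul_smul₀ hc f⟩)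

theorem Submodule.exists_forall_mem_span_singleton (W : Submodule K V) (z : V) :
    ∃ z' : W, ∀ q : W, (q : V) ∈ Submodule.span K {z} → q ∈ Submodule.span K {z'} := by
  by_cases hz : z ∈ W
  · refine ⟨⟨z, hz⟩, fun q hq => ?_⟩
    obtain ⟨c, hc⟩ := Submodule.mem_span_singleton.1 hq
    exact Submodule.mem_span_singleton.2 ⟨c, Subtype.ext hc⟩
  · refine ⟨0, fun q hq => ?_⟩
    obtain ⟨c, hc⟩ := Submodule.mem_span_singleton.1 hq
    have hc0 : c = 0 := by
      by_contra hc0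
      exact hz ((W.smul_mem_iff hc0).1 (hc ▸ q.2))
    have : q = 0 := Subtype.ext (by simp [← hc, hc0])
    simp [this]

theorem add_add_ne_zero_of_ne_zero {x y z : K} (hx : x ≠ 0) (hy : y ≠ 0) (hz : z ≠ 0) :
    (∃ a : K, a ≠ 0 ∧ a ≠ 1) ∨ x + y + z ≠ 0 := by
  by_contra! ⟨hK, h⟩
  have h2 : (1 : K) + 1 = 0 := by
    by_contra h2
    simpa using hK _ h2
  rw [hK x hx, hK y hy, hK z hz, h2, zero_add] at h
  exact one_ne_zero h

variable [FiniteDimensional K V]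

theorem exists_two_apply_ne_zero_notMem_span
    (hV : (∃ a : K, a ≠ 0 ∧ a ≠ 1) ∧ 2 ≤ finrank K V ∨ 3 ≤ finrank K V)
    {f₁ f₂ : Dual K V} (h₁ : f₁ ≠ 0) (h₂ : f₂ ≠ 0) (z : V) :
    ∃ q, f₁ q ≠ 0 ∧ f₂ q ≠ 0 ∧ q ∉ Submodule.span K {z} := by
  obtain ⟨q, hq1, hq2⟩ := exists_two_apply_ne_zero h₁ h₂
  by_cases hqz : q ∈ Submodule.span K {z}; swap
  · exact ⟨q, hq1, hq2, hqz⟩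
  rcases hV with ⟨hK, hV⟩ | hV
  · obtain ⟨k, hk0, hk⟩ := exists_ne_zero_forall_apply_eq_zero ![f₁] hV
    have hk1 : f₁ k = 0 := hk 0
    obtain ⟨c, hc, hc'⟩ := exists_ne_zero_add_mul_ne_zero hK hq2 (f₂ k)
    exact ⟨q + c • k, by simpa [hk1], by simpa using hc',
      add_notMem_span_singleton hq1 (by simp [hk1]) (smul_ne_zero hc hk0) hqz⟩
  · obtain ⟨k, hk0, hk⟩ := exists_ne_zero_forall_apply_eq_zero ![f₁, f₂] hV
    have hk1 : f₁ k = 0 := hk 0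
    have hk2 : f₂ k = 0 := hk 1
    exact ⟨q + k, by simpa [hk1], by simpa [hk2],
      add_notMem_span_singleton hq1 hk1 hk0 hqz⟩

theorem exists_three_apply_ne_zero_notMem_span
    (hV : (∃ a : K, a ≠ 0 ∧ a ≠ 1) ∧ 3 ≤ finrank K V ∨ 4 ≤ finrank K V)
    {f₁ f₂ f₃ : Dual K V} (h₁ : f₁ ≠ 0) (h₂ : f₂ ≠ 0) (h₃ : f₃ ≠ 0)
    (h : (∃ a : K, a ≠ 0 ∧ a ≠ 1) ∨ f₁ + f₂ + f₃ ≠ 0) (z : V) :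
    ∃ q, f₁ q ≠ 0 ∧ f₂ q ≠ 0 ∧ f₃ q ≠ 0 ∧ q ∉ Submodule.span K {z} := by
  obtain ⟨q, hq1, hq2, hq3⟩ := exists_three_apply_ne_zero h₁ h₂ h₃ h
  by_cases hqz : q ∈ Submodule.span K {z}; swap
  · exact ⟨q, hq1, hq2, hq3, hqz⟩
  rcases hV with ⟨hK, hV⟩ | hV
  · obtain ⟨k, hk0, hk⟩ := exists_ne_zero_forall_apply_eq_zero ![f₁, f₂] hV
    have hk1 : f₁ k = 0 := hk 0
    have hk2 : f₂ k = 0 := hk 1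
    obtain ⟨c, hc, hc'⟩ := exists_ne_zero_add_mul_ne_zero hK hq3 (f₃ k)
    exact ⟨q + c • k, by simpa [hk1], by simpa [hk2], by simpa using hc',
      add_notMem_span_singleton hq1 (by simp [hk1]) (smul_ne_zero hc hk0) hqz⟩
  · obtain ⟨k, hk0, hk⟩ := exists_ne_zero_forall_apply_eq_zero ![f₁, f₂, f₃] hV
    have hk1 : f₁ k = 0 := hk 0
    have hk2 : f₂ k = 0 := hk 1
    have hk3 : f₃ k = 0 := hk 2
    exact ⟨q + k, by simpa [hk1], by simpa [hk2], by simpa [hk3],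
      add_notMem_span_singleton hq1 hk1 hk0 hqz⟩

theorem exists_apply_ne_zero_notMem_span_notMem_span
    (hV : (∃ a : K, a ≠ 0 ∧ a ≠ 1) ∧ 2 ≤ finrank K V ∨ 3 ≤ finrank K V)
    {f : Dual K V} (hf : f ≠ 0) (z₁ z₂ : V) :
    ∃ q, f q ≠ 0 ∧ q ∉ Submodule.span K {z₁} ∧ q ∉ Submodule.span K {z₂} := by
  have hlt : Submodule.span K {z₁} < ⊤ := lt_top_iff_ne_top.2 fun h => by
    have := finrank_le_one z₁ fun w =>
      Submodule.mem_span_singleton.1 (h ▸ Submodule.mem_top : w ∈ Submodule.span K {z₁})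
    omega
  obtain ⟨l, hl0, hl⟩ := Submodule.exists_le_ker_of_lt_top _ hlt
  obtain ⟨q, hq, hlq, hqz⟩ := exists_two_apply_ne_zero_notMem_span hV hf hl0 z₂
  exact ⟨q, hq, fun h => hlq (hl h), hqz⟩

theorem exists_two_apply_ne_zero_notMem_span_notMem_span
    (hV : (∃ a : K, a ≠ 0 ∧ a ≠ 1) ∧ 3 ≤ finrank K V ∨ 4 ≤ finrank K V)
    {f₁ f₂ : Dual K V} (h₁ : f₁ ≠ 0) (h₂ : f₂ ≠ 0) (z₁ z₂ : V) :
    ∃ q, f₁ q ≠ 0 ∧ f₂ q ≠ 0 ∧ q ∉ Submodule.span K {z₁} ∧ q ∉ Submodule.span K {z₂} := by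
  have hs : finrank K (Submodule.span K {z₁, z₂}) ≤ 2 := by
    classical
    have := finrank_span_finset_le_card (R := K) ({z₁, z₂} : Finset V)
    rw [Set.finrank, Finset.coe_pair] at this
    exact this.trans Finset.card_le_two
  obtain ⟨w, hw, hK⟩ : ∃ w, w ∉ Submodule.span K {z₁, z₂} ∧
      ((∃ a : K, a ≠ 0 ∧ a ≠ 1) ∨ (f₁ + f₂) w = 0) := by
    rcases hV with ⟨hK, hV⟩ | hV
    · obtain ⟨w, hw⟩ : ∃ w, w ∉ Submodule.span K {z₁, z₂} := by
        by_contra! hcon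
        rw [Submodule.eq_top_iff'.2 hcon, finrank_top] at hs
        omega
      exact ⟨w, hw, .inl hK⟩
    · have hk : ¬ LinearMap.ker (f₁ + f₂) ≤ Submodule.span K {z₁, z₂} := fun hle => by
        have h1 := Submodule.finrank_mono hle
        have h2 := LinearMap.finrank_range_add_finrank_ker (f₁ + f₂)
        have h3 := (LinearMap.range (f₁ + f₂)).finrank_le
        rw [finrank_self] at h3
        omega
      obtain ⟨w, hw, hw'⟩ := SetLike.not_le_iff_exists.1 hk
      exact ⟨w, hw', .inr hw⟩
  obtain ⟨l, hlw, hl⟩ := Submodule.exists_le_ker_of_notMem hw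
  obtain ⟨q, hq1, hq2, hql⟩ := exists_three_apply_ne_zero h₁ h₂ (f₃ := l)
    (by rintro rfl; simp at hlw) (hK.imp_right fun h0 hsum => hlw (by
      have := LinearMap.congr_fun hsum w
      rwa [LinearMap.add_apply, h0, zero_add] at this))
  exact ⟨q, hq1, hq2, fun h => hql (hl (Submodule.span_mono (by simp) h)),
    fun h => hql (hl (Submodule.span_mono (by simp) h))⟩

section AntiFlagVectors

variable (hV : (∃ a : K, a ≠ 0 ∧ a ≠ 1) ∧ 3 ≤ finrank K V ∨ 4 ≤ finrank K V)
  {f₁ f₂ f : Dual K V} {p₁ p₂ : V} (h₁ : f₁ p₁ ≠ 0) (h₂ : f₂ p₂ ≠ 0)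
  (hf₁ : f ∉ Submodule.span K {f₁}) (hf₂ : f ∉ Submodule.span K {f₂})

include hV in
theorem finrank_ker_bound (hf : f ≠ 0) :
    (∃ a : K, a ≠ 0 ∧ a ≠ 1) ∧ 2 ≤ finrank K (LinearMap.ker f) ∨
      3 ≤ finrank K (LinearMap.ker f) := by
  have := Dual.finrank_ker_add_one_of_ne_zero hf
  exact hV.imp (fun h => ⟨h.1, by omega⟩) fun h => by omega

theorem eval_ne_zero {p : V} (hp : p ≠ 0) : Dual.eval K V p ≠ 0 := by
  intro h
  exact hp ((Module.forall_dual_apply_eq_zero_iff K p).1 fun φ => LinearMap.congr_fun h φ)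

include hV in
theorem exists_dual_three_apply_ne_zero {q : V} (hp₁ : p₁ ≠ 0) (hp₂ : p₂ ≠ 0) (hq : q ≠ 0)
    (h : (∃ a : K, a ≠ 0 ∧ a ≠ 1) ∨ p₁ + p₂ + q ≠ 0) (φ : Dual K V) :
    ∃ g : Dual K V, g p₁ ≠ 0 ∧ g p₂ ≠ 0 ∧ g q ≠ 0 ∧ g ∉ Submodule.span K {φ} := by
  rw [← Subspace.dual_finrank_eq] at hV
  exact exists_three_apply_ne_zero_notMem_span hV (eval_ne_zero hp₁) (eval_ne_zero hp₂)
    (eval_ne_zero hq) (h.imp_right fun h => by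
      rw [← map_add, ← map_add]
      exact eval_ne_zero h) φ

include hV h₁ h₂ hf₁ hf₂ in
theorem exists_antiflag_of_apply_eq_zero (h : f₂ p₁ = 0) :
    ∃ (q : V) (g : Dual K V), f q = 0 ∧ f₁ q ≠ 0 ∧ f₂ q ≠ 0 ∧
      q ∉ Submodule.span K {p₁} ∧ q ∉ Submodule.span K {p₂} ∧
      g p₁ ≠ 0 ∧ g p₂ ≠ 0 ∧ g q ≠ 0 ∧
      g ∉ Submodule.span K {f₁} ∧ g ∉ Submodule.span K {f₂} := by
  have hf : f ≠ 0 := fun h => hf₁ (h ▸ Submodule.zero_mem _)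
  have h₁0 : f₁ ≠ 0 := fun h => h₁ (by simp [h])
  have h₂0 : f₂ ≠ 0 := fun h => h₂ (by simp [h])
  have hp₁0 : p₁ ≠ 0 := fun h => h₁ (by simp [h])
  have hp₂0 : p₂ ≠ 0 := fun h => h₂ (by simp [h])
  obtain ⟨q, hfq, hq1, hq2, hqp, hsum⟩ : ∃ q : V, f q = 0 ∧ f₁ q ≠ 0 ∧ f₂ q ≠ 0 ∧
      q ∉ Submodule.span K {p₂} ∧ ((∃ a : K, a ≠ 0 ∧ a ≠ 1) ∨ p₁ + p₂ + q ≠ 0) := by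
    by_cases h' : f₁ p₂ = 0
    · obtain ⟨z, hz⟩ := (LinearMap.ker f).exists_forall_mem_span_singleton (p₁ + p₂)
      obtain ⟨q, hq1, hq2, hqz⟩ := exists_two_apply_ne_zero_notMem_span (finrank_ker_bound hV hf)
        (domRestrict_ker_ne_zero h₁0 hf₁) (domRestrict_ker_ne_zero h₂0 hf₂) z
      refine ⟨q, q.2, hq1, hq2, notMem_span_singleton_of_apply hq1 h', .inr fun hs => ?_⟩
      refine hqz (hz q (Submodule.mem_span_singleton.2 ⟨-1, ?_⟩))
      rw [neg_one_smul, eq_comm]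
      exact eq_neg_of_add_eq_zero_right hs
    · obtain ⟨z, hz⟩ := (LinearMap.ker f).exists_forall_mem_span_singleton p₂
      obtain ⟨q, hq1, hq2, hqz⟩ := exists_two_apply_ne_zero_notMem_span (finrank_ker_bound hV hf)
        (domRestrict_ker_ne_zero h₁0 hf₁) (domRestrict_ker_ne_zero h₂0 hf₂) z
      refine ⟨q, q.2, hq1, hq2, fun hq => hqz (hz q hq), ?_⟩
      exact (add_add_ne_zero_of_ne_zero h₁ h' hq1).imp_right fun hne hs => hne (by
        simpa using congrArg f₁ hs)
  have hq0 : q ≠ 0 := fun h => hq1 (by simp [h])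
  obtain ⟨g, hg1, hg2, hgq, hgf⟩ := exists_dual_three_apply_ne_zero hV hp₁0 hp₂0 hq0 hsum f₁
  exact ⟨q, g, hfq, hq1, hq2, notMem_span_singleton_of_apply hq2 h, hqp, hg1, hg2, hgq, hgf,
    notMem_span_singleton_of_apply (f := Dual.eval K V p₁) hg1 h⟩

include hV h₁ h₂ hf₁ in
theorem exists_antiflag_of_mem_span (h : f₁ ∈ Submodule.span K {f₂}) :
    ∃ (q : V) (g : Dual K V), f q = 0 ∧ f₁ q ≠ 0 ∧ f₂ q ≠ 0 ∧
      q ∉ Submodule.span K {p₁} ∧ q ∉ Submodule.span K {p₂} ∧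
      g p₁ ≠ 0 ∧ g p₂ ≠ 0 ∧ g q ≠ 0 ∧
      g ∉ Submodule.span K {f₁} ∧ g ∉ Submodule.span K {f₂} := by
  have hf : f ≠ 0 := fun h => hf₁ (h ▸ Submodule.zero_mem _)
  have h₁0 : f₁ ≠ 0 := fun h => h₁ (by simp [h])
  have hp₁0 : p₁ ≠ 0 := fun h => h₁ (by simp [h])
  have hp₂0 : p₂ ≠ 0 := fun h => h₂ (by simp [h])
  obtain ⟨z₁, hz₁⟩ := (LinearMap.ker f).exists_forall_mem_span_singleton p₁
  obtain ⟨z₂, hz₂⟩ := (LinearMap.ker f).exists_forall_mem_span_singleton p₂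
  obtain ⟨q, hq1, hqz₁, hqz₂⟩ := exists_apply_ne_zero_notMem_span_notMem_span
    (finrank_ker_bound hV hf) (domRestrict_ker_ne_zero h₁0 hf₁) z₁ z₂
  have hq0 : (q : V) ≠ 0 := fun h => hq1 (by simp [h])
  obtain ⟨c, rfl⟩ := Submodule.mem_span_singleton.1 h
  have hc : c ≠ 0 := fun hc => h₁0 (by simp [hc])
  have hq1' : (c • f₂) q ≠ 0 := hq1
  have hsum := add_add_ne_zero_of_ne_zero h₁ (y := (c • f₂) p₂) (by simp [hc, h₂]) hq1'
  obtain ⟨g, hg1, hg2, hgq, hgf⟩ := exists_dual_three_apply_ne_zero hV hp₁0 hp₂0 hq0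
    (hsum.imp_right fun hne hs => hne (by rw [← map_add, ← map_add, hs, map_zero])) f₂
  refine ⟨q, g, q.2, hq1', fun h0 => hq1' (by simp [h0]), fun hq => hqz₁ (hz₁ q hq),
    fun hq => hqz₂ (hz₂ q hq), hg1, hg2, hgq, fun hg => hgf ?_, hgf⟩
  exact (Submodule.span_singleton_le_iff_mem _ _).2 h hg

include hV h₁ h₂ hf₁ hf₂ in
theorem exists_antiflag_of_mem_span' (h : p₁ ∈ Submodule.span K {p₂}) :
    ∃ (q : V) (g : Dual K V), f q = 0 ∧ f₁ q ≠ 0 ∧ f₂ q ≠ 0 ∧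
      q ∉ Submodule.span K {p₁} ∧ q ∉ Submodule.span K {p₂} ∧
      g p₁ ≠ 0 ∧ g p₂ ≠ 0 ∧ g q ≠ 0 ∧
      g ∉ Submodule.span K {f₁} ∧ g ∉ Submodule.span K {f₂} := by
  have hf : f ≠ 0 := fun h => hf₁ (h ▸ Submodule.zero_mem _)
  have h₁0 : f₁ ≠ 0 := fun h => h₁ (by simp [h])
  have h₂0 : f₂ ≠ 0 := fun h => h₂ (by simp [h])
  have hp₁0 : p₁ ≠ 0 := fun h => h₁ (by simp [h])
  have hp₂0 : p₂ ≠ 0 := fun h => h₂ (by simp [h])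
  obtain ⟨z, hz⟩ := (LinearMap.ker f).exists_forall_mem_span_singleton p₂
  obtain ⟨q, hq1, hq2, hqz⟩ := exists_two_apply_ne_zero_notMem_span (finrank_ker_bound hV hf)
    (domRestrict_ker_ne_zero h₁0 hf₁) (domRestrict_ker_ne_zero h₂0 hf₂) z
  have hq0 : (q : V) ≠ 0 := fun h => hq1 (by simp [h])
  rw [← Subspace.dual_finrank_eq] at hV
  obtain ⟨g, hg2, hgq, hgf1, hgf2⟩ := exists_two_apply_ne_zero_notMem_span_notMem_span hV
    (eval_ne_zero hp₂0) (eval_ne_zero hq0) f₁ f₂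
  have hle := (Submodule.span_singleton_le_iff_mem _ _).2 h
  refine ⟨q, g, q.2, hq1, hq2, fun hq => hqz (hz q (hle hq)), fun hq => hqz (hz q hq), ?_,
    hg2, hgq, hgf1, hgf2⟩
  obtain ⟨c, rfl⟩ := Submodule.mem_span_singleton.1 h
  have hc : c ≠ 0 := fun hc => hp₁0 (by simp [hc])
  rw [map_smul]
  exact smul_ne_zero hc hg2

include hV h₁ h₂ hf₁ hf₂ in
theorem exists_antiflag_apply_eq_zero (h : f₁ p₂ = 0 ∨ f₂ p₁ = 0 ∨
    f₁ ∈ Submodule.span K {f₂} ∨ p₁ ∈ Submodule.span K {p₂}) :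
    ∃ (q : V) (g : Dual K V), f q = 0 ∧ f₁ q ≠ 0 ∧ f₂ q ≠ 0 ∧
      q ∉ Submodule.span K {p₁} ∧ q ∉ Submodule.span K {p₂} ∧
      g p₁ ≠ 0 ∧ g p₂ ≠ 0 ∧ g q ≠ 0 ∧
      g ∉ Submodule.span K {f₁} ∧ g ∉ Submodule.span K {f₂} := by
  rcases h with h | h | h | h
  · obtain ⟨q, g, h⟩ := exists_antiflag_of_apply_eq_zero hV h₂ h₁ hf₂ hf₁ h
    exact ⟨q, g, by tauto⟩
  · exact exists_antiflag_of_apply_eq_zero hV h₁ h₂ hf₁ hf₂ h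
  · exact exists_antiflag_of_mem_span hV h₁ h₂ hf₁ h
  · exact exists_antiflag_of_mem_span' hV h₁ h₂ hf₁ hf₂ h

/-- The dual form of `exists_antiflag_apply_eq_zero`. -/
theorem exists_antiflag_apply_eq_zero' {p : V}
    (hV : (∃ a : K, a ≠ 0 ∧ a ≠ 1) ∧ 3 ≤ finrank K V ∨ 4 ≤ finrank K V)
    (h₁ : f₁ p₁ ≠ 0) (h₂ : f₂ p₂ ≠ 0)
    (hp₁ : p ∉ Submodule.span K {p₁}) (hp₂ : p ∉ Submodule.span K {p₂})
    (h : f₁ p₂ = 0 ∨ f₂ p₁ = 0 ∨ f₁ ∈ Submodule.span K {f₂} ∨ p₁ ∈ Submodule.span K {p₂}) :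
    ∃ (q : V) (g : Dual K V), g p = 0 ∧ f₁ q ≠ 0 ∧ f₂ q ≠ 0 ∧
      q ∉ Submodule.span K {p₁} ∧ q ∉ Submodule.span K {p₂} ∧
      g p₁ ≠ 0 ∧ g p₂ ≠ 0 ∧ g q ≠ 0 ∧
      g ∉ Submodule.span K {f₁} ∧ g ∉ Submodule.span K {f₂} := by
  have hspan (x y : V) : Dual.eval K V x ∈ Submodule.span K {Dual.eval K V y} ↔
      x ∈ Submodule.span K {y} := by
    simp only [Submodule.mem_span_singleton, ← map_smul]
    simp only [← Module.evalEquiv_toLinearMap, LinearEquiv.coe_coe, EmbeddingLike.apply_eq_iff_eq]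
  rw [← Subspace.dual_finrank_eq] at hV
  obtain ⟨g, ψ, hg⟩ := exists_antiflag_apply_eq_zero hV (f := Dual.eval K V p)
    (f₁ := Dual.eval K V p₁) (f₂ := Dual.eval K V p₂) (p₁ := f₁) (p₂ := f₂) h₁ h₂
    (by rwa [hspan]) (by rwa [hspan]) (by
      rw [hspan]
      simp only [Dual.eval_apply]
      tauto)
  obtain ⟨q, rfl⟩ := (Module.evalEquiv K V).surjective ψ
  refine ⟨q, g, ?_⟩
  simp only [← LinearEquiv.coe_coe, Module.evalEquiv_toLinearMap, hspan, Dual.eval_apply] at hg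
  tauto

end AntiFlagVectors

end Avoidance

namespace AntiFlag

theorem ext_of_eq {A B : AntiFlag F n} (hpt : A.pt = B.pt) (hhyp : A.hyp = B.hyp) : A = B := by
  cases A
  cases B
  cases hpt
  cases hhyp
  rfl

theorem exists_vectors (hn : 3 ≤ n) (A : AntiFlag F n) :
    ∃ (p : Fin n → F) (f : Dual F (Fin n → F)),
      A.pt = Submodule.span F {p} ∧ A.hyp = LinearMap.ker f ∧ f p ≠ 0 := by
  obtain ⟨p, hp⟩ : ∃ p, A.pt = Submodule.span F {p} := by
    obtain ⟨v, hv⟩ := finrank_eq_one_iff'.1 A.pt_rank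
    refine ⟨v, le_antisymm (fun w hw => ?_) ((Submodule.span_singleton_le_iff_mem _ _).2 v.2)⟩
    obtain ⟨c, hc⟩ := hv.2 ⟨w, hw⟩
    exact Submodule.mem_span_singleton.2 ⟨c, congrArg Subtype.val hc⟩
  obtain ⟨f, hf⟩ : ∃ f : Dual F (Fin n → F), A.hyp = LinearMap.ker f := by
    obtain ⟨f, hf0, hf⟩ := Submodule.exists_le_ker_of_lt_top A.hyp
      (lt_top_iff_ne_top.2 fun h => A.not_incident (h ▸ le_top))
    have hr := Dual.finrank_ker_add_one_of_ne_zero hf0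
    rw [finrank_fin_fun] at hr
    exact ⟨f, Submodule.eq_of_le_of_finrank_eq hf (by rw [A.hyp_rank]; omega)⟩
  refine ⟨p, f, hp, hf, fun h => A.not_incident ?_⟩
  rw [hp, hf]
  exact (Submodule.span_singleton_le_iff_mem _ _).2 h

theorem exists_eq_span_eq_ker {q : Fin n → F} {g : Dual F (Fin n → F)} (h : g q ≠ 0) :
    ∃ C : AntiFlag F n, C.pt = Submodule.span F {q} ∧ C.hyp = LinearMap.ker g := by
  have hr := Dual.finrank_ker_add_one_of_ne_zero (f := g) (by rintro rfl; simp at h)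
  rw [finrank_fin_fun] at hr
  exact ⟨⟨Submodule.span F {q}, LinearMap.ker g,
    finrank_span_singleton (by rintro rfl; simp at h), by omega,
    fun hle => h ((Submodule.span_singleton_le_iff_mem _ _).1 hle)⟩, rfl, rfl⟩

theorem adj4_of_vectors {B C : AntiFlag F n} {p q : Fin n → F} {f g : Dual F (Fin n → F)}
    (hBp : B.pt = Submodule.span F {p}) (hBf : B.hyp = LinearMap.ker f)
    (hCq : C.pt = Submodule.span F {q}) (hCg : C.hyp = LinearMap.ker g)
    (hq : q ∉ Submodule.span F {p}) (hg : g ∉ Submodule.span F {f})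
    (hfq : f q ≠ 0) (hgp : g p ≠ 0) : adj4 B C := by
  have hpt : B.pt ≠ C.pt := fun h => hq (by
    rw [← hBp, h, hCq]
    exact Submodule.mem_span_singleton_self q)
  refine ⟨fun h => hpt (h ▸ rfl), hpt, fun h => hg (mem_span_singleton_of_ker_le_ker ?_), ?_, ?_⟩
  · rw [← hBf, ← hCg, h]
  · rw [hBp, hCg]
    exact fun h => hgp ((Submodule.span_singleton_le_iff_mem _ _).1 h)
  · rw [hCq, hBf]
    exact fun h => hfq ((Submodule.span_singleton_le_iff_mem _ _).1 h)

theorem finrank_bound (hn : 3 ≤ n) (hcard : 3 ≤ Cardinal.mk F ∨ 4 ≤ n) :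
    (∃ a : F, a ≠ 0 ∧ a ≠ 1) ∧ 3 ≤ finrank F (Fin n → F) ∨ 4 ≤ finrank F (Fin n → F) := by
  rw [finrank_fin_fun]
  exact hcard.imp_left fun h => ⟨Cardinal.exists_ne_ne_of_three_le h 0 1, hn⟩

theorem vectors_of_not_adj4 {B₁ B₂ : AntiFlag F n} {p₁ p₂ : Fin n → F}
    {f₁ f₂ : Dual F (Fin n → F)}
    (hp₁ : B₁.pt = Submodule.span F {p₁}) (hf₁ : B₁.hyp = LinearMap.ker f₁)
    (hp₂ : B₂.pt = Submodule.span F {p₂}) (hf₂ : B₂.hyp = LinearMap.ker f₂)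
    (h : ¬ adj4 B₁ B₂) :
    f₁ p₂ = 0 ∨ f₂ p₁ = 0 ∨ f₁ ∈ Submodule.span F {f₂} ∨ p₁ ∈ Submodule.span F {p₂} := by
  by_contra! ⟨h₁, h₂, h₃, h₄⟩
  have hadj : adj4 B₂ B₁ := adj4_of_vectors hp₂ hf₂ hp₁ hf₁ h₄ h₃ h₂ h₁
  obtain ⟨h1, h2, h3, h4, h5⟩ := hadj
  exact h ⟨h1.symm, h2.symm, h3.symm, h5, h4⟩

theorem hyp_eq_or_hyp_eq (hn : 3 ≤ n) (hcard : 3 ≤ Cardinal.mk F ∨ 4 ≤ n)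
    {A B₁ B₂ : AntiFlag F n} (hB : ¬ adj4 B₁ B₂)
    (h : ∀ C ∈ perpSet adj4 {B₁, B₂}, ¬ C.pt ≤ A.hyp) : A.hyp = B₁.hyp ∨ A.hyp = B₂.hyp := by
  obtain ⟨p, f, -, hf, hfp⟩ := A.exists_vectors hn
  obtain ⟨p₁, f₁, hp₁, hf₁, hfp₁⟩ := B₁.exists_vectors hn
  obtain ⟨p₂, f₂, hp₂, hf₂, hfp₂⟩ := B₂.exists_vectors hn
  have key {B : AntiFlag F n} {f' : Dual F (Fin n → F)} (hB : B.hyp = LinearMap.ker f')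
      (hne : A.hyp ≠ B.hyp) : f ∉ Submodule.span F {f'} := by
    intro hmem
    refine hne (Submodule.eq_of_le_of_finrank_eq ?_ (by rw [A.hyp_rank, B.hyp_rank])).symm
    obtain ⟨c, rfl⟩ := Submodule.mem_span_singleton.1 hmem
    rw [hB, hf]
    exact LinearMap.ker_le_ker_smul f' c
  by_contra! ⟨h₁, h₂⟩
  obtain ⟨q, g, hfq, hq₁, hq₂, hqp₁, hqp₂, hg₁, hg₂, hgq, hgf₁, hgf₂⟩ :=
    exists_antiflag_apply_eq_zero (finrank_bound hn hcard) hfp₁ hfp₂ (key hf₁ h₁) (key hf₂ h₂)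
      (vectors_of_not_adj4 hp₁ hf₁ hp₂ hf₂ hB)
  obtain ⟨C, hCq, hCg⟩ := exists_eq_span_eq_ker hgq
  refine h C ?_ ?_
  · rintro B (rfl | rfl)
    · exact adj4_of_vectors hp₁ hf₁ hCq hCg hqp₁ hgf₁ hq₁ hg₁
    · exact adj4_of_vectors hp₂ hf₂ hCq hCg hqp₂ hgf₂ hq₂ hg₂
  · rw [hCq, hf]
    exact (Submodule.span_singleton_le_iff_mem _ _).2 hfq

theorem pt_eq_or_pt_eq (hn : 3 ≤ n) (hcard : 3 ≤ Cardinal.mk F ∨ 4 ≤ n)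
    {A B₁ B₂ : AntiFlag F n} (hB : ¬ adj4 B₁ B₂)
    (h : ∀ C ∈ perpSet adj4 {B₁, B₂}, ¬ A.pt ≤ C.hyp) : A.pt = B₁.pt ∨ A.pt = B₂.pt := by
  obtain ⟨p, f, hp, -, hfp⟩ := A.exists_vectors hn
  obtain ⟨p₁, f₁, hp₁, hf₁, hfp₁⟩ := B₁.exists_vectors hn
  obtain ⟨p₂, f₂, hp₂, hf₂, hfp₂⟩ := B₂.exists_vectors hn
  have key {B : AntiFlag F n} {p' : Fin n → F} (hB : B.pt = Submodule.span F {p'})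
      (hne : A.pt ≠ B.pt) : p ∉ Submodule.span F {p'} := by
    intro hmem
    refine hne (Submodule.eq_of_le_of_finrank_eq ?_ (by rw [A.pt_rank, B.pt_rank]))
    rw [hp, hB]
    exact (Submodule.span_singleton_le_iff_mem _ _).2 hmem
  by_contra! ⟨h₁, h₂⟩
  obtain ⟨q, g, hgp, hq₁, hq₂, hqp₁, hqp₂, hg₁, hg₂, hgq, hgf₁, hgf₂⟩ :=
    exists_antiflag_apply_eq_zero' (finrank_bound hn hcard) hfp₁ hfp₂ (key hp₁ h₁) (key hp₂ h₂)
      (vectors_of_not_adj4 hp₁ hf₁ hp₂ hf₂ hB)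
  obtain ⟨C, hCq, hCg⟩ := exists_eq_span_eq_ker hgq
  refine h C ?_ ?_
  · rintro B (rfl | rfl)
    · exact adj4_of_vectors hp₁ hf₁ hCq hCg hqp₁ hgf₁ hq₁ hg₁
    · exact adj4_of_vectors hp₂ hf₂ hCq hCg hqp₂ hgf₂ hq₂ hg₂
  · rw [hp, hCg]
    exact (Submodule.span_singleton_le_iff_mem _ _).2 hgp

theorem pt_and_hyp_of_perpSet_subset (hn : 3 ≤ n) (hcard : 3 ≤ Cardinal.mk F ∨ 4 ≤ n)
    {B₁ B₂ : AntiFlag F n} {X : Set (AntiFlag F n)} (hB : ¬ adj4 B₁ B₂)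
    (h : perpSet adj4 {B₁, B₂} ⊆ perpSet adj4 X) {A : AntiFlag F n} (hA : A ∈ X) :
    (A.pt = B₁.pt ∨ A.pt = B₂.pt) ∧ (A.hyp = B₁.hyp ∨ A.hyp = B₂.hyp) :=
  ⟨pt_eq_or_pt_eq hn hcard hB fun _ hC => (h hC A hA).2.2.2.1,
    hyp_eq_or_hyp_eq hn hcard hB fun _ hC => (h hC A hA).2.2.2.2⟩

theorem pair_eq_of_perpSet_subset_of_adj2_right (hn : 3 ≤ n)
    (hcard : 3 ≤ Cardinal.mk F ∨ 4 ≤ n) {A₁ A₂ B₁ B₂ : AntiFlag F n} (hA : adj2 A₁ A₂)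
    (hB : ¬ adj4 B₁ B₂) (h : perpSet adj4 {B₁, B₂} ⊆ perpSet adj4 {A₁, A₂}) :
    ({A₁, A₂} : Set (AntiFlag F n)) = {B₁, B₂} := by
  obtain ⟨hp₁, hh₁⟩ := pt_and_hyp_of_perpSet_subset hn hcard hB h (A := A₁) (by simp)
  obtain ⟨hp₂, hh₂⟩ := pt_and_hyp_of_perpSet_subset hn hcard hB h (A := A₂) (by simp)
  obtain ⟨-, h12, h21⟩ := hA
  have hpt : A₁.pt ≠ A₂.pt := fun he => A₂.not_incident (he ▸ h12)
  have hhyp : A₁.hyp ≠ A₂.hyp := fun he => A₁.not_incident (he ▸ h12)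
  have hn₁ := B₁.not_incident
  have hn₂ := B₂.not_incident
  rcases hp₁ with hp₁ | hp₁ <;> rcases hp₂ with hp₂ | hp₂ <;>
    rcases hh₁ with hh₁ | hh₁ <;> rcases hh₂ with hh₂ | hh₂ <;>
    simp only [hp₁, hp₂, hh₁, hh₂, ne_eq, not_true_eq_false] at h12 h21 hpt hhyp <;>
    first
    | contradiction
    | (rw [ext_of_eq hp₁ hh₁, ext_of_eq hp₂ hh₂]; done)
    | rw [ext_of_eq hp₁ hh₁, ext_of_eq hp₂ hh₂, Set.pair_comm]

theorem not_adj4_of_adj2 {A₁ A₂ : AntiFlag F n} (h : adj2 A₁ A₂) : ¬ adj4 A₁ A₂ :=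
  fun h' => h'.2.2.2.1 h.2.1

theorem pair_eq_of_perpSet_subset_of_adj2_left (hn : 3 ≤ n)
    (hcard : 3 ≤ Cardinal.mk F ∨ 4 ≤ n) {A₁ A₂ B₁ B₂ : AntiFlag F n} (hA : adj2 A₁ A₂)
    (hB : B₁ ≠ B₂) (h : perpSet adj4 {A₁, A₂} ⊆ perpSet adj4 {B₁, B₂}) :
    ({A₁, A₂} : Set (AntiFlag F n)) = {B₁, B₂} := by
  have key (B : AntiFlag F n) (hmem : B ∈ ({B₁, B₂} : Set (AntiFlag F n))) :
      B = A₁ ∨ B = A₂ := by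
    have hinc := B.not_incident
    obtain ⟨hp | hp, hh | hh⟩ :=
      pt_and_hyp_of_perpSet_subset hn hcard (not_adj4_of_adj2 hA) h hmem
    · exact .inl (ext_of_eq hp hh)
    · exact absurd (hp ▸ hh ▸ hA.2.1) hinc
    · exact absurd (hp ▸ hh ▸ hA.2.2) hinc
    · exact .inr (ext_of_eq hp hh)
  rcases key B₁ (by simp) with rfl | rfl <;> rcases key B₂ (by simp) with rfl | rfl
  · exact absurd rfl hB
  · rfl
  · exact Set.pair_comm _ _
  · exact absurd rfl hB

end AntiFlag

theorem stmt7 (hn : 3 ≤ n) (hcard : 3 ≤ Cardinal.mk F ∨ 4 ≤ n)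
    (A1 A2 : AntiFlag F n) (h : adj2 A1 A2) :
    (∀ Y ∈ famX F n, ¬ Y ⊂ perpSet adj4 {A1, A2}) ∧
    (∀ Y ∈ famX F n, ¬ perpSet adj4 {A1, A2} ⊂ Y) := by
  constructor
  · rintro _ ⟨B₁, B₂, -, hB, rfl⟩ hlt
    exact hlt.ne (by rw [AntiFlag.pair_eq_of_perpSet_subset_of_adj2_right hn hcard h hB hlt.subset])
  · rintro _ ⟨B₁, B₂, hne, -, rfl⟩ hlt
    exact hlt.ne (by rw [AntiFlag.pair_eq_of_perpSet_subset_of_adj2_left hn hcard h hne hlt.subset])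
end

section
/- Suppose F is the field with two elements and n = 3. Then distinct point-hyperplane anti-flags A_1, A_2 satisfy A_1 ~_2 A_2 if and only if there exists an anti-flag that is 4-adjacent to both A_1 and A_2 (i.e., {A_1, A_2}^{~_4} is non-empty). -/
variable {F : Type*} [Field F] {n : ℕ}

open Matrix

/-- The anti-flag formed by the line spanned by `v` and the hyperplane orthogonal to `f`. -/
def AntiFlag.ofVectors (v f : Fin n → F) (h : f ⬝ᵥ v = 1) : AntiFlag F n where
  pt := Submodule.span F {v}
  hyp := LinearMap.ker (dotProductEquiv F (Fin n) f)
  pt_rank := finrank_span_singleton (by rintro rfl; simp at h)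
  hyp_rank := by
    have hf : dotProductEquiv F (Fin n) f ≠ 0 := by
      rw [Ne, LinearEquiv.map_eq_zero_iff]
      rintro rfl
      simp at h
    have := Module.Dual.finrank_ker_add_one_of_ne_zero hf
    rw [Module.finrank_fin_fun] at this
    omega
  not_incident := by simp [Submodule.span_singleton_le_iff_mem, h]

theorem AntiFlag.exists_eq_ofVectors (A : AntiFlag F n) :
    ∃ (v f : Fin n → F) (h : f ⬝ᵥ v = 1), A = ofVectors v f h := by
  obtain ⟨p, H, hp, hH, hpH⟩ := A
  obtain ⟨v, hv, hvH⟩ := SetLike.not_le_iff_exists.mp hpH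
  obtain ⟨φ, hφ, hker⟩ := Submodule.exists_le_ker_of_notMem hvH
  have hv0 : v ≠ 0 := by rintro rfl; simp at hvH
  have hspan : Submodule.span F {v} = p :=
    Submodule.eq_of_le_of_finrank_eq (by simpa using hv) (by rw [finrank_span_singleton hv0, hp])
  have hφ0 : φ ≠ 0 := by rintro rfl; simp at hφ
  have hHφ : H = LinearMap.ker φ := by
    have := Module.Dual.finrank_ker_add_one_of_ne_zero hφ0
    rw [Module.finrank_fin_fun] at this
    exact Submodule.eq_of_le_of_finrank_eq hker (by omega)
  obtain ⟨f, hf⟩ := (dotProductEquiv F (Fin n)).surjective ((φ v)⁻¹ • φ)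
  have hfv : dotProductEquiv F (Fin n) f v = 1 := by simp [hf, hφ]
  refine ⟨v, f, hfv, ?_⟩
  simp only [ofVectors, AntiFlag.mk.injEq, hspan, hf, hHφ, true_and]
  exact (LinearMap.ker_smul _ _ (inv_ne_zero hφ)).symm

theorem AntiFlag.ofVectors_pt_le_hyp {v f w g : Fin n → F} (h : f ⬝ᵥ v = 1) (h' : g ⬝ᵥ w = 1) :
    (ofVectors v f h).pt ≤ (ofVectors w g h').hyp ↔ g ⬝ᵥ v = 0 := by
  simp [ofVectors, Submodule.span_singleton_le_iff_mem]

theorem ZMod.ne_zero_iff_eq_one (a : ZMod 2) : a ≠ 0 ↔ a = 1 := by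
  revert a
  decide

theorem AntiFlag.ofVectors_pt_eq_iff {v f w g : Fin n → ZMod 2}
    (h : f ⬝ᵥ v = 1) (h' : g ⬝ᵥ w = 1) :
    (ofVectors v f h).pt = (ofVectors w g h').pt ↔ v = w := by
  refine ⟨fun e => ?_, fun e => by simp [ofVectors, e]⟩
  have hv : v ∈ Submodule.span (ZMod 2) {w} := by
    have : v ∈ (ofVectors v f h).pt := Submodule.mem_span_singleton_self v
    rwa [e] at this
  obtain ⟨c, rfl⟩ := Submodule.mem_span_singleton.mp hv
  have hc : c ≠ 0 := by rintro rfl; simp at h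
  rw [(ZMod.ne_zero_iff_eq_one c).mp hc, one_smul]

theorem AntiFlag.ofVectors_hyp_eq_iff {v f w g : Fin n → ZMod 2}
    (h : f ⬝ᵥ v = 1) (h' : g ⬝ᵥ w = 1) :
    (ofVectors v f h).hyp = (ofVectors w g h').hyp ↔ f = g := by
  refine ⟨fun e => ?_, fun e => by simp [ofVectors, e]⟩
  refine dotProduct_eq _ _ fun x => ?_
  have hx : f ⬝ᵥ x = 0 ↔ g ⬝ᵥ x = 0 := by
    simpa [ofVectors] using SetLike.ext_iff.mp e x
  by_cases h0 : f ⬝ᵥ x = 0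
  · rw [h0, hx.mp h0]
  · rw [(ZMod.ne_zero_iff_eq_one _).mp h0, (ZMod.ne_zero_iff_eq_one _).mp (mt hx.mpr h0)]

theorem AntiFlag.adj4_ofVectors_iff {v f w g : Fin n → ZMod 2}
    (h : f ⬝ᵥ v = 1) (h' : g ⬝ᵥ w = 1) :
    adj4 (ofVectors v f h) (ofVectors w g h') ↔
      v ≠ w ∧ f ≠ g ∧ g ⬝ᵥ v = 1 ∧ f ⬝ᵥ w = 1 := by
  simp only [adj4, ne_eq, ofVectors_pt_eq_iff, ofVectors_hyp_eq_iff, ofVectors_pt_le_hyp,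
    ← ZMod.ne_zero_iff_eq_one, and_iff_right_iff_imp]
  rintro ⟨hvw, -⟩ e
  exact hvw ((ofVectors_pt_eq_iff h h').mp (congrArg AntiFlag.pt e))

set_option synthInstance.maxSize 512 in
/-- A nonzero vector of `𝔽₂³` orthogonal to two distinct nonzero vectors is their cross product. -/
theorem eq_crossProduct_of_dotProduct_eq_zero {f s t : Fin 3 → ZMod 2} (hf : f ≠ 0)
    (hs : s ≠ 0) (ht : t ≠ 0) (hst : s ≠ t) (hfs : f ⬝ᵥ s = 0) (hft : f ⬝ᵥ t = 0) :
    f = s ⨯₃ t := by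
  revert f s t
  decide +kernel

/-- Two vectors of `𝔽₂³` having scalar product one with the same three distinct vectors
coincide. -/
theorem eq_of_dotProduct_eq_one {f g x y z : Fin 3 → ZMod 2}
    (hxy : x ≠ y) (hxz : x ≠ z) (hyz : y ≠ z)
    (hfx : f ⬝ᵥ x = 1) (hfy : f ⬝ᵥ y = 1) (hfz : f ⬝ᵥ z = 1)
    (hgx : g ⬝ᵥ x = 1) (hgy : g ⬝ᵥ y = 1) (hgz : g ⬝ᵥ z = 1) : f = g := by
  have key {h : Fin 3 → ZMod 2} (hx : h ⬝ᵥ x = 1) (hy : h ⬝ᵥ y = 1) (hz : h ⬝ᵥ z = 1) :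
      h = (x - y) ⨯₃ (x - z) :=
    eq_crossProduct_of_dotProduct_eq_zero (by rintro rfl; simp at hx) (sub_ne_zero.mpr hxy)
      (sub_ne_zero.mpr hxz) (by simpa using hyz) (by simp [dotProduct_sub, hx, hy])
      (by simp [dotProduct_sub, hx, hz])
  rw [key hfx hfy hfz, key hgx hgy hgz]

theorem stmt9 (A1 A2 : AntiFlag (ZMod 2) 3) (hne : A1 ≠ A2) :
    adj2 A1 A2 ↔ (perpSet adj4 {A1, A2}).Nonempty := by
  obtain ⟨v₁, f₁, h₁, rfl⟩ := A1.exists_eq_ofVectors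
  obtain ⟨v₂, f₂, h₂, rfl⟩ := A2.exists_eq_ofVectors
  simp only [adj2, ne_eq, hne, not_false_eq_true, true_and, AntiFlag.ofVectors_pt_le_hyp]
  constructor
  · rintro ⟨h21, h12⟩
    have two : (1 : ZMod 2) + 1 = 0 := rfl
    have e (x y : Fin 3 → ZMod 2) : x ⨯₃ y ⬝ᵥ x = 0 ∧ x ⨯₃ y ⬝ᵥ y = 0 :=
      ⟨by rw [dotProduct_comm, dot_self_cross], by rw [dotProduct_comm, dot_cross_self]⟩
    have hgv₁ : (f₁ + f₂ + v₁ ⨯₃ v₂) ⬝ᵥ v₁ = 1 := by simp [add_dotProduct, h₁, h21, e]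
    have hgv₂ : (f₁ + f₂ + v₁ ⨯₃ v₂) ⬝ᵥ v₂ = 1 := by simp [add_dotProduct, h₂, h12, e]
    have hfw₁ : f₁ ⬝ᵥ (v₁ + v₂ + f₁ ⨯₃ f₂) = 1 := by simp [dotProduct_add, h₁, h12]
    have hfw₂ : f₂ ⬝ᵥ (v₁ + v₂ + f₁ ⨯₃ f₂) = 1 := by simp [dotProduct_add, h₂, h21]
    have hgw : (f₁ + f₂ + v₁ ⨯₃ v₂) ⬝ᵥ (v₁ + v₂ + f₁ ⨯₃ f₂) = 1 := by
      rw [dotProduct_add, dotProduct_add, hgv₁, hgv₂, two, zero_add, add_dotProduct,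
        add_dotProduct, dot_self_cross, dot_cross_self, cross_dot_cross,
        dotProduct_comm v₁, dotProduct_comm v₂, dotProduct_comm v₁, dotProduct_comm v₂,
        h₁, h₂, h12, h21]
      simp
    refine ⟨AntiFlag.ofVectors _ _ hgw, ?_⟩
    rintro A (rfl | rfl) <;> rw [AntiFlag.adj4_ofVectors_iff]
    · refine ⟨?_, ?_, hgv₁, hfw₁⟩ <;> intro e'
      · rw [← e', h21] at hfw₂
        exact zero_ne_one hfw₂
      · rw [← e', h12] at hgv₂
        exact zero_ne_one hgv₂
    · refine ⟨?_, ?_, hgv₂, hfw₂⟩ <;> intro e'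
      · rw [← e', h12] at hfw₁
        exact zero_ne_one hfw₁
      · rw [← e', h21] at hgv₁
        exact zero_ne_one hgv₁
  · rintro ⟨B, hB⟩
    obtain ⟨w, g, hgw, rfl⟩ := B.exists_eq_ofVectors
    obtain ⟨hvw₁, hfg₁, hgv₁, hfw₁⟩ :=
      (AntiFlag.adj4_ofVectors_iff h₁ hgw).mp (hB _ (Set.mem_insert _ _))
    obtain ⟨hvw₂, hfg₂, hgv₂, hfw₂⟩ :=
      (AntiFlag.adj4_ofVectors_iff h₂ hgw).mp (hB _ (Set.mem_insert_of_mem _ rfl))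
    have hv : v₁ ≠ v₂ := by
      rintro rfl
      have hf : f₁ ≠ f₂ := by rintro rfl; exact hne rfl
      refine hvw₁ (eq_of_dotProduct_eq_one hf hfg₁ hfg₂ ?_ ?_ ?_ ?_ ?_ ?_) <;>
        rwa [dotProduct_comm]
    constructor <;> by_contra hc <;> rw [← ne_eq, ZMod.ne_zero_iff_eq_one] at hc
    · exact hfg₂ (eq_of_dotProduct_eq_one hv hvw₁ hvw₂ hc h₂ hfw₂ hgv₁ hgv₂ hgw)
    · exact hfg₁ (eq_of_dotProduct_eq_one hv hvw₁ hvw₂ h₁ hc hfw₁ hgv₁ hgv₂ hgw)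
end

section
/- Suppose |F| ≥ 4. Two distinct point-hyperplane anti-flags A_1, A_2 are 3-adjacent if and only if there exists a 4-element coclique C of the graph Γ_1 satisfying property (L) with A_1 ∈ C and A_2 ∈ C. -/
variable {F : Type*} [Field F] {n : ℕ}

/-- A coclique of the graph `Γ₁`: no two distinct members are `1`-adjacent. -/
def IsCoclique1 (C : Set (AntiFlag F n)) : Prop := ∀ A ∈ C, ∀ B ∈ C, ¬ adj1 A B

/-- Property (L): for every anti-flag `A ∉ C`, the set `A^{~₁} ∩ C` is empty,
a singleton, all of `C` with exactly one element removed, or all of `C`. -/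
def PropL (C : Set (AntiFlag F n)) : Prop :=
  ∀ A : AntiFlag F n, A ∉ C →
    {B ∈ C | adj1 A B} = ∅ ∨ (∃ B, {B0 ∈ C | adj1 A B0} = {B}) ∨
    (∃ B ∈ C, {B0 ∈ C | adj1 A B0} = C \ {B}) ∨ {B ∈ C | adj1 A B} = C

open Submodule

/-- The orthogonal complement of a vector under the dot product. -/
def perp (a : Fin n → F) : Submodule F (Fin n → F) :=
  LinearMap.ker (dotProductEquiv F (Fin n) a)

theorem mem_perp {a x : Fin n → F} : x ∈ perp a ↔ a ⬝ᵥ x = 0 := Iff.rfl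

theorem mem_perp_comm {a x : Fin n → F} : x ∈ perp a ↔ a ∈ perp x := by
  rw [mem_perp, mem_perp, dotProduct_comm]

theorem span_singleton_le_perp {v a : Fin n → F} : span F {v} ≤ perp a ↔ a ⬝ᵥ v = 0 :=
  span_singleton_le_iff_mem v (perp a)

theorem finrank_perp {a : Fin n → F} (ha : a ≠ 0) : Module.finrank F (perp a) = n - 1 := by
  have h := Module.Dual.finrank_ker_add_one_of_ne_zero
    (f := dotProductEquiv F (Fin n) a) (by simpa using ha)
  rw [Module.finrank_fin_fun] at h
  unfold perp
  omega

theorem mem_span_of_perp_le {a b : Fin n → F} (h : perp a ≤ perp b) : b ∈ span F {a} := by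
  by_cases ha : a = 0
  · subst ha
    have hb : b = 0 := dotProduct_eq_zero b fun w => h (by simp [mem_perp])
    simp [hb]
  · obtain ⟨i, hi⟩ := Function.ne_iff.mp ha
    have hi' : a i ≠ 0 := hi
    have key : ∀ w, b ⬝ᵥ w = ((b ⬝ᵥ Pi.single i (a i)⁻¹) • a) ⬝ᵥ w := by
      intro w
      have hw : w - (a ⬝ᵥ w) • Pi.single i (a i)⁻¹ ∈ perp a := by
        rw [mem_perp, dotProduct_sub, dotProduct_smul, dotProduct_single, mul_inv_cancel₀ hi']
        simp
      have := mem_perp.mp (h hw)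
      rw [dotProduct_sub, dotProduct_smul, sub_eq_zero] at this
      rw [this, smul_dotProduct, smul_eq_mul, smul_eq_mul, mul_comm]
    rw [dotProduct_eq _ _ key]
    exact smul_mem _ _ (mem_span_singleton_self a)

theorem span_singleton_eq_of_mem {K V : Type*} [Field K] [AddCommGroup V] [Module K V]
    {a b : V} (hb : b ≠ 0) (h : b ∈ span K {a}) : span K {b} = span K {a} := by
  obtain ⟨c, rfl⟩ := mem_span_singleton.mp h
  exact span_singleton_smul_eq (IsUnit.mk0 c fun hc => hb (by simp [hc])) a

theorem perp_eq_perp_iff {a b : Fin n → F} : perp a = perp b ↔ span F {a} = span F {b} := by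
  constructor
  · intro h
    exact le_antisymm ((span_singleton_le_iff_mem _ _).mpr (mem_span_of_perp_le h.ge))
      ((span_singleton_le_iff_mem _ _).mpr (mem_span_of_perp_le h.le))
  · intro h
    ext x
    rw [mem_perp_comm, mem_perp_comm (a := b), ← span_singleton_le_iff_mem,
      ← span_singleton_le_iff_mem, h]

/-- A subspace is not covered by at most `#K` subspaces, none of which contains it. -/
theorem exists_mem_forall_notMem {K V ι : Type*} [Field K] [AddCommGroup V] [Module K V]
    (U : Submodule K V) (W : ι → Submodule K V) (s : Finset ι)
    (hs : (s.card : Cardinal) ≤ Cardinal.mk K) (h : ∀ i ∈ s, ¬ U ≤ W i) :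
    ∃ x ∈ U, ∀ i ∈ s, x ∉ W i := by
  classical
  induction s using Finset.induction_on with
  | empty => exact ⟨0, U.zero_mem, by simp⟩
  | insert a s ha ih =>
    rw [Finset.card_insert_of_notMem ha] at hs
    obtain ⟨x, hxU, hx⟩ := ih (le_trans (by exact_mod_cast Nat.le_succ _) hs)
      fun i hi => h i (Finset.mem_insert_of_mem hi)
    by_cases hxa : x ∈ W a
    swap
    · exact ⟨x, hxU, by simpa [hxa] using hx⟩
    obtain ⟨y, hyU, hya⟩ := SetLike.not_le_iff_exists.mp (h a (Finset.mem_insert_self a s))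
    have hmem : ∀ c : K, y + c • x ∈ U := fun c => U.add_mem hyU (U.smul_mem c hxU)
    have hna : ∀ c : K, y + c • x ∉ W a := fun c hc =>
      hya ((Submodule.add_mem_iff_left _ ((W a).smul_mem c hxa)).mp hc)
    by_contra! hcov
    have hex : ∀ c : K, ∃ i : s, y + c • x ∈ W i := by
      intro c
      obtain ⟨i, hi, hi'⟩ := hcov _ (hmem c)
      rcases Finset.mem_insert.mp hi with rfl | hi
      · exact absurd hi' (hna c)
      · exact ⟨⟨i, hi⟩, hi'⟩
    choose f hf using hex
    have hinj : Function.Injective f := by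
      intro c d hcd
      by_contra hne
      have h1 := (W (f c)).sub_mem (hf c) (hcd ▸ hf d)
      rw [add_sub_add_left_eq_sub, ← sub_smul] at h1
      exact hx _ (f c).2 (((W (f c)).smul_mem_iff (sub_ne_zero.mpr hne)).mp h1)
    have hle := Cardinal.lift_mk_le_lift_mk_of_injective hinj
    rw [Cardinal.mk_coe_finset, Cardinal.lift_natCast] at hle
    have hle' : Cardinal.mk K ≤ s.card := by simpa using hle
    have := hs.trans hle'
    norm_cast at this
    omega

theorem exists_mem_forall_notMem_fin_four (hF : 4 ≤ Cardinal.mk F)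
    (U : Submodule F (Fin n → F)) (W : Fin 4 → Submodule F (Fin n → F)) (h : ∀ i, ¬ U ≤ W i) :
    ∃ x ∈ U, ∀ i, x ∉ W i := by
  obtain ⟨x, hxU, hx⟩ := exists_mem_forall_notMem U W Finset.univ (by simpa using hF)
    fun i _ => h i
  exact ⟨x, hxU, fun i => hx i (Finset.mem_univ i)⟩

theorem not_perp_le_perp {a b : Fin n → F} (hb : b ≠ 0) (h : span F {a} ≠ span F {b}) :
    ¬ perp a ≤ perp b :=
  fun hle => h (span_singleton_eq_of_mem hb (mem_span_of_perp_le hle)).symm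

theorem not_perp_le_span (hn : 3 ≤ n) {a b : Fin n → F} (ha : a ≠ 0) :
    ¬ perp a ≤ span F {b} := by
  intro h
  have h1 := Submodule.finrank_mono h
  have h2 : Module.finrank F (span F {b}) ≤ 1 := by simpa using finrank_span_le_card (R := F) {b}
  rw [finrank_perp ha] at h1
  omega

/-- `Separates v φ` says that some nonincident pair `(x, y)` of a vector and a functional has
exactly two indices `k` for which precisely one of `φ k ⬝ᵥ x` and `y ⬝ᵥ v k` vanishes. -/
def Separates (v φ : Fin 4 → Fin n → F) : Prop :=
  ∃ (x y : Fin n → F) (i j : Fin 4), i ≠ j ∧ y ⬝ᵥ x ≠ 0 ∧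
    ∀ k, Xor (φ k ⬝ᵥ x = 0) (y ⬝ᵥ v k = 0) ↔ k = i ∨ k = j

theorem Separates.swap {v φ : Fin 4 → Fin n → F} (h : Separates v φ) : Separates φ v := by
  obtain ⟨x, y, i, j, hij, hxy, hk⟩ := h
  refine ⟨y, x, i, j, hij, by rwa [dotProduct_comm], fun k => ?_⟩
  rw [← hk k, xor_comm, dotProduct_comm x, dotProduct_comm y]

theorem separates_of_unique (hn : 3 ≤ n) (hF : 4 ≤ Cardinal.mk F) {v φ : Fin 4 → Fin n → F}
    (hv : ∀ k, v k ≠ 0) (hφ : ∀ k, φ k ≠ 0) {i j : Fin 4} (hij : i ≠ j)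
    (hi : ∀ k, k ≠ i → span F {v k} ≠ span F {v i})
    (hj : ∀ k, k ≠ j → span F {φ k} ≠ span F {φ j}) : Separates v φ := by
  obtain ⟨x, hxU, hx⟩ := exists_mem_forall_notMem_fin_four hF (perp (φ j))
    (fun k => if k = j then span F {v i} else perp (φ k)) fun k => by
      by_cases hk : k = j
      · simpa [hk] using not_perp_le_span hn (hφ j)
      · simpa [hk] using not_perp_le_perp (hφ k) (hj k hk).symm
  have hxi : x ∉ span F {v i} := by simpa using hx j
  have hx0 : x ≠ 0 := fun h => hxi (h ▸ zero_mem _)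
  obtain ⟨y, hyU, hy⟩ := exists_mem_forall_notMem_fin_four hF (perp (v i))
    (fun k => if k = i then perp x else perp (v k)) fun k => by
      by_cases hk : k = i
      · simpa [hk] using fun h => hxi (mem_span_of_perp_le h)
      · simpa [hk] using not_perp_le_perp (hv k) (hi k hk).symm
  have hyx : x ⬝ᵥ y ≠ 0 := by simpa [mem_perp] using hy i
  refine ⟨x, y, i, j, hij, by rwa [dotProduct_comm], fun k => ?_⟩
  have h1 : φ k ⬝ᵥ x = 0 ↔ k = j := by
    refine ⟨fun h => ?_, fun h => h ▸ hxU⟩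
    by_contra hk
    exact hx k (by simpa [hk, mem_perp] using h)
  have h2 : y ⬝ᵥ v k = 0 ↔ k = i := by
    rw [dotProduct_comm]
    refine ⟨fun h => ?_, fun h => h ▸ hyU⟩
    by_contra hk
    exact hy k (by simpa [hk, mem_perp] using h)
  rw [h1, h2]
  unfold Xor
  grind

theorem dotProduct_eq_zero_iff_of_span_eq {a b y : Fin n → F} (h : span F {a} = span F {b}) :
    y ⬝ᵥ a = 0 ↔ y ⬝ᵥ b = 0 := by
  rw [← span_singleton_le_perp, h, span_singleton_le_perp]

theorem separates_of_pairs (hF : 4 ≤ Cardinal.mk F) {v φ : Fin 4 → Fin n → F}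
    (hφv : ∀ k, φ k ⬝ᵥ v k ≠ 0) (hsymm : ∀ k l, φ k ⬝ᵥ v l = 0 ↔ φ l ⬝ᵥ v k = 0)
    {i j k : Fin 4} (hij : i ≠ j) (hvij : span F {v j} = span F {v i})
    (hki : span F {v k} ≠ span F {v i})
    (hk : ∀ m, m = i ∨ m = j ∨ span F {v m} = span F {v k}) : Separates v φ := by
  have hv : ∀ k, v k ≠ 0 := fun k h => hφv k (by simp [h])
  have hφ : ∀ k, φ k ≠ 0 := fun k h => hφv k (by simp [h])
  obtain ⟨x, hxφ, hxi⟩ : ∃ x, (∀ m, φ m ⬝ᵥ x ≠ 0) ∧ x ∉ span F {v i} := by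
    by_cases h : φ k ⬝ᵥ v i = 0
    · obtain ⟨x, -, hx⟩ := exists_mem_forall_notMem_fin_four hF ⊤ (fun m => perp (φ m))
        fun m hm => hφv m (hm (mem_top (x := v m)))
      exact ⟨x, hx, fun hxi => hx k (span_singleton_le_perp.mpr h hxi)⟩
    · refine ⟨v k, fun m => ?_, fun hmem => hki (span_singleton_eq_of_mem (hv k) hmem)⟩
      rcases hk m with rfl | rfl | hm
      · rwa [Ne, hsymm]
      · rwa [Ne, hsymm, dotProduct_eq_zero_iff_of_span_eq hvij]
      · rw [Ne, ← dotProduct_eq_zero_iff_of_span_eq hm]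
        exact hφv m
  obtain ⟨y, hyU, hy⟩ := exists_mem_forall_notMem_fin_four hF (perp (v i))
    (fun m => if m = 0 then perp x else perp (v k)) fun m => by
      by_cases hm : m = 0
      · simpa [hm] using fun h => hxi (mem_span_of_perp_le h)
      · simpa [hm] using not_perp_le_perp (hv k) hki.symm
  have hyx : x ⬝ᵥ y ≠ 0 := by simpa [mem_perp] using hy 0
  have hyk : y ⬝ᵥ v k ≠ 0 := by simpa [mem_perp, dotProduct_comm] using hy 1
  have hyi : y ⬝ᵥ v i = 0 := by rw [dotProduct_comm]; exact hyU
  refine ⟨x, y, i, j, hij, by rwa [dotProduct_comm], fun m => ?_⟩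
  have hyj : y ⬝ᵥ v j = 0 := (dotProduct_eq_zero_iff_of_span_eq hvij).mpr hyi
  have h2 : y ⬝ᵥ v m = 0 ↔ m = i ∨ m = j := by
    refine ⟨fun h => ?_, by rintro (rfl | rfl) <;> assumption⟩
    rcases hk m with hm | hm | hm
    · exact Or.inl hm
    · exact Or.inr hm
    · exact absurd ((dotProduct_eq_zero_iff_of_span_eq hm).mp h) hyk
  simp [Xor, h2, hxφ m]

theorem fin_four_partition {α : Type*} (a : Fin 4 → α) (h : a 0 ≠ a 1) :
    (∃ i j k, i ≠ j ∧ a j = a i ∧ a k ≠ a i ∧ ∀ m, m = i ∨ m = j ∨ a m = a k) ∨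
    (∃ i j, i ≠ j ∧ (∀ k, k ≠ i → a k ≠ a i) ∧ ∀ k, k ≠ j → a k ≠ a j) ∨
    ∃ i, (∀ k, k ≠ i → a k ≠ a i) ∧ ∀ j k, j ≠ i → k ≠ i → a j = a k := by
  have h4 : ∀ P : Fin 4 → Prop, (∀ k, P k) ↔ P 0 ∧ P 1 ∧ P 2 ∧ P 3 := fun P => by
    simp [Fin.forall_fin_succ]
  by_cases h02 : a 2 = a 0
  · by_cases h03 : a 3 = a 0
    · exact Or.inr (Or.inr ⟨1, by simp only [h4]; grind⟩)
    · by_cases h13 : a 3 = a 1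
      · exact Or.inl ⟨0, 2, 1, by simp only [h4]; grind⟩
      · exact Or.inr (Or.inl ⟨1, 3, by simp only [h4]; grind⟩)
  · by_cases h12 : a 2 = a 1
    · by_cases h03 : a 3 = a 0
      · exact Or.inl ⟨0, 3, 1, by simp only [h4]; grind⟩
      · by_cases h13 : a 3 = a 1
        · exact Or.inr (Or.inr ⟨0, by simp only [h4]; grind⟩)
        · exact Or.inr (Or.inl ⟨0, 3, by simp only [h4]; grind⟩)
    · by_cases h03 : a 3 = a 0
      · exact Or.inr (Or.inl ⟨1, 2, by simp only [h4]; grind⟩)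
      · by_cases h13 : a 3 = a 1
        · exact Or.inr (Or.inl ⟨0, 2, by simp only [h4]; grind⟩)
        · exact Or.inr (Or.inl ⟨0, 1, by simp only [h4]; grind⟩)

theorem separates_of_ne (hn : 3 ≤ n) (hF : 4 ≤ Cardinal.mk F) {v φ : Fin 4 → Fin n → F}
    (hφv : ∀ k, φ k ⬝ᵥ v k ≠ 0) (hsymm : ∀ k l, φ k ⬝ᵥ v l = 0 ↔ φ l ⬝ᵥ v k = 0)
    (hinj : ∀ i j, span F {v i} = span F {v j} → span F {φ i} = span F {φ j} → i = j)
    (h0 : span F {v 0} ≠ span F {v 1}) (h1 : span F {φ 0} ≠ span F {φ 1}) :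
    Separates v φ := by
  have hv : ∀ k, v k ≠ 0 := fun k h => hφv k (by simp [h])
  have hφ : ∀ k, φ k ≠ 0 := fun k h => hφv k (by simp [h])
  rcases fin_four_partition (fun k => span F {v k}) h0 with
    ⟨i, j, k, hij, hvij, hki, hk⟩ | hA
  · exact separates_of_pairs hF hφv hsymm hij hvij hki hk
  rcases fin_four_partition (fun k => span F {φ k}) h1 with
    ⟨i, j, k, hij, hvij, hki, hk⟩ | hB
  · refine (separates_of_pairs hF (fun k => ?_) (fun k l => ?_) hij hvij hki hk).swap
    · rw [dotProduct_comm]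
      exact hφv k
    · rw [dotProduct_comm, dotProduct_comm (v l)]
      exact hsymm l k
  have hpair : ∀ i j, i ≠ j → (∀ k, k ≠ i → span F {v k} ≠ span F {v i}) →
      (∀ k, k ≠ j → span F {φ k} ≠ span F {φ j}) → Separates v φ :=
    fun i j hij hi hj => separates_of_unique hn hF hv hφ hij hi hj
  rcases hA with ⟨i, j, hij, hi, hj⟩ | ⟨i, hi, hi'⟩
  · have : ∃ k, ∀ l, l ≠ k → span F {φ l} ≠ span F {φ k} := by
      rcases hB with ⟨k, -, -, hk, -⟩ | ⟨k, hk, -⟩ <;> exact ⟨k, hk⟩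
    obtain ⟨k, hk⟩ := this
    by_cases hik : i = k
    · exact hpair j k (fun h => hij (hik.trans h.symm)) hj hk
    · exact hpair i k hik hi hk
  · rcases hB with ⟨j, k, hjk, hj, hk⟩ | ⟨j, hj, hj'⟩
    · by_cases hij : i = j
      · exact hpair i k (fun h => hjk (hij.symm.trans h)) hi hk
      · exact hpair i j hij hi hj
    · by_cases hij : i = j
      · subst hij
        obtain ⟨k, l, hki, hli, hkl⟩ : ∃ k l : Fin 4, k ≠ i ∧ l ≠ i ∧ k ≠ l := by
          clear * -
          revert i
          decide
        exact absurd (hinj k l (hi' k l hki hli) (hj' k l hki hli)) hkl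
      · exact hpair i j hij hi hj

theorem AntiFlag.exists_rep (A : AntiFlag F n) :
    ∃ v φ : Fin n → F, A.pt = span F {v} ∧ A.hyp = perp φ ∧ φ ⬝ᵥ v ≠ 0 := by
  obtain ⟨v, -, hv⟩ := (finrank_eq_one_iff' (K := F) (V := A.pt)).mp A.pt_rank
  have hpt : A.pt = span F {(v : Fin n → F)} := by
    refine le_antisymm (fun w hw => ?_) ((span_singleton_le_iff_mem _ _).mpr v.2)
    obtain ⟨c, hc⟩ := hv ⟨w, hw⟩
    exact mem_span_singleton.mpr ⟨c, congrArg Subtype.val hc⟩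
  have hvH : (v : Fin n → F) ∉ A.hyp := fun h =>
    A.not_incident (hpt ▸ (span_singleton_le_iff_mem _ _).mpr h)
  obtain ⟨f, hfv, hf⟩ := exists_le_ker_of_notMem hvH
  obtain ⟨φ, rfl⟩ := (dotProductEquiv F (Fin n)).surjective f
  have hφv : φ ⬝ᵥ (v : Fin n → F) ≠ 0 := hfv
  refine ⟨v, φ, hpt, eq_of_le_of_finrank_eq hf ?_, hφv⟩
  exact A.hyp_rank.trans (finrank_perp fun h => hφv (by simp [h])).symm

/-- The anti-flag with the given point vector and functional. -/
def AntiFlag.ofVec (v φ : Fin n → F) (h : φ ⬝ᵥ v ≠ 0) : AntiFlag F n where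
  pt := span F {v}
  hyp := perp φ
  pt_rank := finrank_span_singleton fun hv => h (by simp [hv])
  hyp_rank := finrank_perp fun hφ => h (by simp [hφ])
  not_incident := fun hle => h (span_singleton_le_perp.mp hle)

theorem AntiFlag.eq_of_pt_eq_of_hyp_eq {A B : AntiFlag F n} (hp : A.pt = B.pt)
    (hh : A.hyp = B.hyp) : A = B := by
  cases A
  cases B
  simp_all

theorem adj1_iff_xor {A B : AntiFlag F n} (h : A ≠ B) :
    adj1 A B ↔ Xor (A.pt ≤ B.hyp) (B.pt ≤ A.hyp) := by
  simp [adj1, h, Xor]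

theorem IsCoclique1.pt_le_hyp_comm {C : Set (AntiFlag F n)} (hC : IsCoclique1 C)
    {A B : AntiFlag F n} (hA : A ∈ C) (hB : B ∈ C) : A.pt ≤ B.hyp ↔ B.pt ≤ A.hyp := by
  by_cases h : A = B
  · rw [h]
  · have := hC A hA B hB
    rw [adj1_iff_xor h] at this
    exact not_xor _ _ |>.mp this

theorem adj3_of_propL (hn : 3 ≤ n) (hF : 4 ≤ Cardinal.mk F) {A1 A2 : AntiFlag F n}
    (hne : A1 ≠ A2) {C : Set (AntiFlag F n)} (hC : IsCoclique1 C) (hcard : C.ncard = 4)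
    (hL : PropL C) (h1 : A1 ∈ C) (h2 : A2 ∈ C) : adj3 A1 A2 := by
  by_contra hadj
  simp only [adj3, hne, ne_eq, not_false_eq_true, true_and, not_or] at hadj
  have hsub : {A1, A2} ⊆ C := by
    rintro _ (rfl | rfl) <;> assumption
  have hdiff : (C \ {A1, A2}).ncard = 2 := by
    rw [Set.ncard_sdiff hsub, Set.ncard_pair hne, hcard]
  obtain ⟨B, D, hBD, hCD⟩ := Set.ncard_eq_two.mp hdiff
  have hB : B ∈ C \ {A1, A2} := by simp [hCD]
  have hD : D ∈ C \ {A1, A2} := by simp [hCD]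
  have hCeq : ∀ A ∈ C, A = A1 ∨ A = A2 ∨ A = B ∨ A = D := by
    intro A hA
    by_cases h : A ∈ ({A1, A2} : Set _)
    · rcases h with h | h
      · exact Or.inl h
      · exact Or.inr (Or.inl h)
    · have : A ∈ ({B, D} : Set _) := hCD ▸ ⟨hA, h⟩
      exact Or.inr (Or.inr this)
  simp only [Set.mem_sdiff, Set.mem_insert_iff, Set.mem_singleton_iff, not_or] at hB hD
  obtain ⟨E, hE0, hE1, hEinj, hEC, hEsurj⟩ : ∃ E : Fin 4 → AntiFlag F n, E 0 = A1 ∧ E 1 = A2 ∧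
      Function.Injective E ∧ (∀ k, E k ∈ C) ∧ ∀ A ∈ C, ∃ k, A = E k := by
    refine ⟨![A1, A2, B, D], rfl, rfl, ?_, ?_, ?_⟩
    · intro i j
      fin_cases i <;> fin_cases j <;> simp <;> grind
    · intro k
      fin_cases k
      exacts [h1, h2, hB.1, hD.1]
    · intro A hA
      rcases hCeq A hA with h | h | h | h
      exacts [⟨0, h⟩, ⟨1, h⟩, ⟨2, h⟩, ⟨3, h⟩]
  choose v φ hpt hhyp hφv using fun k => (E k).exists_rep
  have hinc : ∀ k l, (E l).pt ≤ (E k).hyp ↔ φ k ⬝ᵥ v l = 0 := fun k l => by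
    rw [hpt, hhyp, span_singleton_le_perp]
  obtain ⟨x, y, i, j, hij, hyx, hxy⟩ : Separates v φ := by
    refine separates_of_ne hn hF hφv (fun k l => ?_) (fun i j hv hφ => ?_) ?_ ?_
    · rw [← hinc, ← hinc]
      exact hC.pt_le_hyp_comm (hEC l) (hEC k)
    · refine hEinj (AntiFlag.eq_of_pt_eq_of_hyp_eq ?_ ?_)
      · rw [hpt, hpt, hv]
      · rw [hhyp, hhyp, perp_eq_perp_iff, hφ]
    · rw [← hpt, ← hpt, hE0, hE1]
      exact hadj.1
    · rw [Ne, ← perp_eq_perp_iff, ← hhyp, ← hhyp, hE0, hE1]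
      exact hadj.2
  have hxor : ∀ k, Xor ((AntiFlag.ofVec x y hyx).pt ≤ (E k).hyp)
      ((E k).pt ≤ (AntiFlag.ofVec x y hyx).hyp) ↔ k = i ∨ k = j := fun k => by
    rw [← hxy k, hpt, hhyp]
    simp only [AntiFlag.ofVec, span_singleton_le_perp]
  have hnot : AntiFlag.ofVec x y hyx ∉ C := fun hmem =>
    (not_xor _ _).mpr (hC.pt_le_hyp_comm hmem (hEC i)) ((hxor i).mpr (Or.inl rfl))
  have hS : ∀ k, adj1 (AntiFlag.ofVec x y hyx) (E k) ↔ k = i ∨ k = j := fun k => by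
    have hk : AntiFlag.ofVec x y hyx ≠ E k := fun h => hnot (by rw [h]; exact hEC k)
    rw [adj1_iff_xor hk, hxor k]
  have hSeq : {B ∈ C | adj1 (AntiFlag.ofVec x y hyx) B} = {E i, E j} := by
    ext A
    constructor
    · rintro ⟨hA, hadjA⟩
      obtain ⟨k, rfl⟩ := hEsurj A hA
      rcases (hS k).mp hadjA with rfl | rfl <;> simp
    · rintro (rfl | rfl)
      · exact ⟨hEC i, (hS i).mpr (Or.inl rfl)⟩
      · exact ⟨hEC j, (hS j).mpr (Or.inr rfl)⟩
  have hS2 : ({E i, E j} : Set (AntiFlag F n)).ncard = 2 :=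
    Set.ncard_pair fun h => hij (hEinj h)
  rcases hL _ hnot with h | ⟨B', h⟩ | ⟨B', hB', h⟩ | h <;> rw [hSeq] at h <;> rw [h] at hS2
  · simp at hS2
  · simp at hS2
  · rw [Set.ncard_sdiff_singleton_of_mem hB'] at hS2
    omega
  · omega

/-- An injective family of pairwise non-`1`-adjacent anti-flags, indexed by the field and meeting
every other anti-flag in at most one exceptional parameter, contains a coclique as required. -/
theorem exists_coclique_of_family (hF : 4 ≤ Cardinal.mk F) (D : F → AntiFlag F n)
    (hD : Function.Injective D) (hc : ∀ c d, ¬ adj1 (D c) (D d))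
    (hA : ∀ A, ∃ (α β : F) (P : Prop), ∀ c, A ≠ D c →
      (adj1 A (D c) ↔ Xor (α + c * β = 0) P)) :
    ∃ C : Set (AntiFlag F n), IsCoclique1 C ∧ C.ncard = 4 ∧ PropL C ∧ D 0 ∈ C ∧ D 1 ∈ C := by
  obtain ⟨T, hT01, -, hT⟩ := Set.exists_superset_subset_encard_eq (k := 4)
    (Set.subset_univ ({0, 1} : Set F))
    (by rw [Set.encard_pair zero_ne_one]; norm_num)
    (by rw [Set.encard_univ, ENat.card]; exact Cardinal.ofNat_le_toENat.mpr hF)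
  refine ⟨D '' T, ?_, ?_, ?_, ⟨0, hT01 (by simp), rfl⟩, ⟨1, hT01 (by simp), rfl⟩⟩
  · rintro _ ⟨c, -, rfl⟩ _ ⟨d, -, rfl⟩
    exact hc c d
  · rw [Set.ncard_image_of_injective _ hD, Set.ncard, hT]
    rfl
  · intro A hAC
    obtain ⟨α, β, P, hP⟩ := hA A
    have hadj : ∀ c ∈ T, (adj1 A (D c) ↔ Xor (α + c * β = 0) P) := fun c hcT =>
      hP c fun h => hAC ⟨c, hcT, h.symm⟩
    have htri : (∀ c ∈ T, α + c * β = 0) ∨ (∃ c₀ ∈ T, ∀ c ∈ T, α + c * β = 0 ↔ c = c₀) ∨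
        ∀ c ∈ T, α + c * β ≠ 0 := by
      by_cases hβ : β = 0
      · by_cases hα : α = 0 <;> simp [hα, hβ]
      · by_cases hex : ∃ c₀ ∈ T, α + c₀ * β = 0
        · obtain ⟨c₀, hc₀, h₀⟩ := hex
          refine Or.inr (Or.inl ⟨c₀, hc₀, fun c _ => ⟨fun h => ?_, fun h => h ▸ h₀⟩⟩)
          exact mul_right_cancel₀ hβ (add_left_cancel (h.trans h₀.symm))
        · push Not at hex
          exact Or.inr (Or.inr hex)
    have hempty : (∀ c ∈ T, ¬ adj1 A (D c)) → {B ∈ D '' T | adj1 A B} = ∅ := by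
      intro h
      ext B
      constructor
      · rintro ⟨⟨c, hcT, rfl⟩, hB⟩
        exact h c hcT hB
      · exact False.elim
    have hall : (∀ c ∈ T, adj1 A (D c)) → {B ∈ D '' T | adj1 A B} = D '' T := by
      intro h
      refine Set.sep_eq_self_iff_mem_true.mpr ?_
      rintro _ ⟨c, hcT, rfl⟩
      exact h c hcT
    by_cases hPt : P
    · have hnadj : ∀ c ∈ T, (adj1 A (D c) ↔ α + c * β ≠ 0) := by simpa [hPt, Xor] using hadj
      rcases htri with h | ⟨c₀, hc₀, h⟩ | h
      · exact Or.inl (hempty fun c hcT => by simp [hnadj c hcT, h c hcT])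
      · refine Or.inr (Or.inr (Or.inl ⟨D c₀, ⟨c₀, hc₀, rfl⟩, ?_⟩))
        ext B
        constructor
        · rintro ⟨⟨c, hcT, rfl⟩, hB⟩
          refine ⟨⟨c, hcT, rfl⟩, fun hcc => ?_⟩
          exact (hnadj c hcT).mp hB ((h c hcT).mpr (hD hcc))
        · rintro ⟨⟨c, hcT, rfl⟩, hB⟩
          refine ⟨⟨c, hcT, rfl⟩, (hnadj c hcT).mpr fun hcc => hB ?_⟩
          exact congrArg D ((h c hcT).mp hcc)
      · exact Or.inr (Or.inr (Or.inr (hall fun c hcT => (hnadj c hcT).mpr (h c hcT))))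
    · have hzadj : ∀ c ∈ T, (adj1 A (D c) ↔ α + c * β = 0) := by simpa [hPt, Xor] using hadj
      rcases htri with h | ⟨c₀, hc₀, h⟩ | h
      · exact Or.inr (Or.inr (Or.inr (hall fun c hcT => (hzadj c hcT).mpr (h c hcT))))
      · refine Or.inr (Or.inl ⟨D c₀, ?_⟩)
        ext B
        constructor
        · rintro ⟨⟨c, hcT, rfl⟩, hB⟩
          exact congrArg D ((h c hcT).mp ((hzadj c hcT).mp hB))
        · rintro rfl
          exact ⟨⟨c₀, hc₀, rfl⟩, (hzadj c₀ hc₀).mpr ((h c₀ hc₀).mpr rfl)⟩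
      · exact Or.inl (hempty fun c hcT => by simp [hzadj c hcT, h c hcT])

theorem exists_span_eq_dotProduct_eq_one {a w : Fin n → F} (h : a ⬝ᵥ w ≠ 0) :
    ∃ b, span F {b} = span F {a} ∧ b ⬝ᵥ w = 1 :=
  ⟨(a ⬝ᵥ w)⁻¹ • a, span_singleton_smul_eq (IsUnit.mk0 _ (inv_ne_zero h)) a, by
    rw [smul_dotProduct, smul_eq_mul, inv_mul_cancel₀ h]⟩

theorem add_smul_sub_dotProduct (a b w : Fin n → F) (c : F) :
    (a + c • (b - a)) ⬝ᵥ w = a ⬝ᵥ w + c * (b ⬝ᵥ w - a ⬝ᵥ w) := by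
  rw [add_dotProduct, smul_dotProduct, sub_dotProduct, smul_eq_mul]

theorem eq_of_span_add_smul_sub_eq {a b w : Fin n → F} (ha : a ⬝ᵥ w = 1) (hb : b ⬝ᵥ w = 1)
    (hab : a ≠ b) {c d : F} (h : span F {a + c • (b - a)} = span F {a + d • (b - a)}) :
    c = d := by
  have hmem : a + c • (b - a) ∈ span F {a + d • (b - a)} := h ▸ mem_span_singleton_self _
  obtain ⟨t, ht⟩ := mem_span_singleton.mp hmem
  have ht1 := congrArg (· ⬝ᵥ w) ht
  simp only [smul_dotProduct, add_smul_sub_dotProduct, ha, hb, sub_self, mul_zero, add_zero,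
    smul_eq_mul, mul_one] at ht1
  rw [ht1, one_smul] at ht
  exact (smul_left_injective F (sub_ne_zero.mpr hab.symm) (add_left_cancel ht)).symm

theorem exists_coclique_of_pt_eq (hF : 4 ≤ Cardinal.mk F) {A1 A2 : AntiFlag F n}
    (hne : A1 ≠ A2) (h : A1.pt = A2.pt) :
    ∃ C : Set (AntiFlag F n), IsCoclique1 C ∧ C.ncard = 4 ∧ PropL C ∧ A1 ∈ C ∧ A2 ∈ C := by
  obtain ⟨v, φ₁, hp₁, hh₁, hφ₁⟩ := A1.exists_rep
  obtain ⟨v₂, φ₂, hp₂, hh₂, hφ₂⟩ := A2.exists_rep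
  rw [Ne, dotProduct_eq_zero_iff_of_span_eq (hp₂.symm.trans (h.symm.trans hp₁))] at hφ₂
  obtain ⟨a, ha, hav⟩ := exists_span_eq_dotProduct_eq_one hφ₁
  obtain ⟨b, hb, hbv⟩ := exists_span_eq_dotProduct_eq_one hφ₂
  rw [← perp_eq_perp_iff, ← hh₁] at ha
  rw [← perp_eq_perp_iff, ← hh₂] at hb
  have hab : a ≠ b := fun hab => hne (AntiFlag.eq_of_pt_eq_of_hyp_eq h (by rw [← ha, hab, hb]))
  have hdot : ∀ c : F, (a + c • (b - a)) ⬝ᵥ v ≠ 0 := fun c => by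
    simp [hav, hbv]
  let D : F → AntiFlag F n := fun c => AntiFlag.ofVec v (a + c • (b - a)) (hdot c)
  have h0 : D 0 = A1 := AntiFlag.eq_of_pt_eq_of_hyp_eq hp₁.symm (by simp [D, AntiFlag.ofVec, ha])
  have h1 : D 1 = A2 := AntiFlag.eq_of_pt_eq_of_hyp_eq (hp₁.symm.trans h)
    (by simp [D, AntiFlag.ofVec, hb])
  rw [← h0, ← h1]
  refine exists_coclique_of_family hF D (fun c d hcd => ?_) (fun c d hcd => ?_) fun A => ?_
  · exact eq_of_span_add_smul_sub_eq hav hbv hab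
      (perp_eq_perp_iff.mp (congrArg AntiFlag.hyp hcd))
  · rcases hcd.2 with h | h
    · exact (D d).not_incident h.1
    · exact (D c).not_incident h.1
  · obtain ⟨x, y, hx, hy, -⟩ := A.exists_rep
    refine ⟨a ⬝ᵥ x, b ⬝ᵥ x - a ⬝ᵥ x, span F {v} ≤ A.hyp, fun c hc => ?_⟩
    rw [adj1_iff_xor hc, hx, ← add_smul_sub_dotProduct, ← span_singleton_le_perp]
    rfl

theorem exists_coclique_of_hyp_eq (hF : 4 ≤ Cardinal.mk F) {A1 A2 : AntiFlag F n}
    (hne : A1 ≠ A2) (h : A1.hyp = A2.hyp) :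
    ∃ C : Set (AntiFlag F n), IsCoclique1 C ∧ C.ncard = 4 ∧ PropL C ∧ A1 ∈ C ∧ A2 ∈ C := by
  obtain ⟨v₁, φ, hp₁, hh₁, hv₁⟩ := A1.exists_rep
  obtain ⟨v₂, φ₂, hp₂, hh₂, hv₂⟩ := A2.exists_rep
  rw [dotProduct_comm] at hv₁
  rw [dotProduct_comm, Ne, dotProduct_eq_zero_iff_of_span_eq
    (perp_eq_perp_iff.mp (hh₂.symm.trans (h.symm.trans hh₁)))] at hv₂
  obtain ⟨a, ha, hav⟩ := exists_span_eq_dotProduct_eq_one hv₁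
  obtain ⟨b, hb, hbv⟩ := exists_span_eq_dotProduct_eq_one hv₂
  rw [← hp₁] at ha
  rw [← hp₂] at hb
  have hab : a ≠ b := fun hab => hne (AntiFlag.eq_of_pt_eq_of_hyp_eq (by rw [← ha, hab, hb]) h)
  have hdot : ∀ c : F, φ ⬝ᵥ (a + c • (b - a)) ≠ 0 := fun c => by
    simp [dotProduct_comm φ, hav, hbv]
  let D : F → AntiFlag F n := fun c => AntiFlag.ofVec (a + c • (b - a)) φ (hdot c)
  have h0 : D 0 = A1 := AntiFlag.eq_of_pt_eq_of_hyp_eq (by simp [D, AntiFlag.ofVec, ha]) hh₁.symm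
  have h1 : D 1 = A2 := AntiFlag.eq_of_pt_eq_of_hyp_eq (by simp [D, AntiFlag.ofVec, hb])
    (hh₁.symm.trans h)
  rw [← h0, ← h1]
  refine exists_coclique_of_family hF D (fun c d hcd => ?_) (fun c d hcd => ?_) fun A => ?_
  · exact eq_of_span_add_smul_sub_eq hav hbv hab (congrArg AntiFlag.pt hcd)
  · rcases hcd.2 with h | h
    · exact (D c).not_incident h.1
    · exact (D d).not_incident h.1
  · obtain ⟨x, y, hx, hy, -⟩ := A.exists_rep
    refine ⟨a ⬝ᵥ y, b ⬝ᵥ y - a ⬝ᵥ y, A.pt ≤ perp φ, fun c hc => ?_⟩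
    rw [adj1_iff_xor hc, hy, ← add_smul_sub_dotProduct, dotProduct_comm,
      ← span_singleton_le_perp, xor_comm]
    rfl

theorem stmt12 (hn : 3 ≤ n) (hF : 4 ≤ Cardinal.mk F)
    (A1 A2 : AntiFlag F n) (hne : A1 ≠ A2) :
    adj3 A1 A2 ↔
      ∃ C : Set (AntiFlag F n), IsCoclique1 C ∧ C.ncard = 4 ∧ PropL C ∧
        A1 ∈ C ∧ A2 ∈ C := by
  constructor
  · rintro ⟨-, h | h⟩
    · exact exists_coclique_of_pt_eq hF hne h
    · exact exists_coclique_of_hyp_eq hF hne h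
  · rintro ⟨C, hC, hcard, hL, h1, h2⟩
    exact adj3_of_propL hn hF hne hC hcard hL h1 h2
end

section
/- Suppose F is a finite field with q elements. Let A_1 = (p_1, H_1) and A_2 = (p_2, H_2) be point-hyperplane anti-flags with A_1 ~_4 A_2. Then: (1) if the line p_1 + p_2 (the 2-dimensional subspace spanned by p_1 and p_2) meets H_1 ∩ H_2 nontrivially, then |{A_1, A_2}^{~_1}| = 4q^{n-2}(q^{n-2} - q^{n-3}) - 2q^{n-2}; (2) if (p_1 + p_2) ∩ (H_1 ∩ H_2) = 0, then |{A_1, A_2}^{~_1}| = 4(q^{n-2} - 1)(q - 1)q^{n-3} + 2q^{n-2}. -/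
variable {F : Type*} [Field F] {n : ℕ}

namespace AntiFlag

open Module

@[ext] theorem ext' {A B : AntiFlag F n} (h1 : A.pt = B.pt) (h2 : A.hyp = B.hyp) : A = B := by
  cases A; cases B; simp_all

theorem exists_vec_form (A : AntiFlag F n) : ∃ (v : Fin n → F) (f : Dual F (Fin n → F)),
    A.pt = F ∙ v ∧ A.hyp = LinearMap.ker f ∧ f v ≠ 0 := by
  obtain ⟨v, -, hv⟩ := finrank_eq_one_iff'.1 A.pt_rank
  have hpt : A.pt = F ∙ (v : Fin n → F) := by
    apply le_antisymm
    · intro x hx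
      obtain ⟨c, hc⟩ := hv ⟨x, hx⟩
      exact Submodule.mem_span_singleton.2 ⟨c, congrArg Subtype.val hc⟩
    · exact (Submodule.span_singleton_le_iff_mem _ _).2 v.2
  have hlt : A.hyp < ⊤ := by
    refine lt_top_iff_ne_top.2 fun h => A.not_incident (h ▸ le_top)
  obtain ⟨f, hf, hle⟩ := Submodule.exists_le_ker_of_lt_top _ hlt
  have hn : finrank F (LinearMap.ker f) < n := by
    have := Submodule.finrank_lt fun h : LinearMap.ker f = ⊤ => hf (LinearMap.ker_eq_top.1 h)
    simpa using this
  have hhyp : A.hyp = LinearMap.ker f := by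
    refine Submodule.eq_of_le_of_finrank_le hle ?_
    have := A.hyp_rank
    omega
  refine ⟨v, f, hpt, hhyp, fun h => A.not_incident ?_⟩
  rw [hpt, hhyp, Submodule.span_singleton_le_iff_mem]
  exact h

theorem pt_le_hyp_iff {A B : AntiFlag F n} {v : Fin n → F} {f : Dual F (Fin n → F)}
    (hv : A.pt = F ∙ v) (hf : B.hyp = LinearMap.ker f) : A.pt ≤ B.hyp ↔ f v = 0 := by
  rw [hv, hf, Submodule.span_singleton_le_iff_mem, LinearMap.mem_ker]

/-- The anti-flag spanned by a vector and cut out by a linear form not vanishing on it. -/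
def ofVecForm (v : Fin n → F) (f : Dual F (Fin n → F)) (h : f v ≠ 0) : AntiFlag F n where
  pt := F ∙ v
  hyp := LinearMap.ker f
  pt_rank := finrank_span_singleton (by rintro rfl; simp at h)
  hyp_rank := by
    have h1 := LinearMap.finrank_range_add_finrank_ker f
    rw [LinearMap.range_eq_top.2 (LinearMap.surjective (by rintro rfl; simp at h))] at h1
    simp at h1
    omega
  not_incident := by
    rwa [Submodule.span_singleton_le_iff_mem]

theorem card_mul_sq [Fintype F] (P : (Fin n → F) → Dual F (Fin n → F) → Prop)
    (S : Set (AntiFlag F n))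
    (hS : ∀ (A : AntiFlag F n) v f, A.pt = F ∙ v → A.hyp = LinearMap.ker f → (A ∈ S ↔ P v f)) :
    S.ncard * (Fintype.card F - 1) ^ 2 =
      Nat.card {x : (Fin n → F) × Dual F (Fin n → F) // x.2 x.1 ≠ 0 ∧ P x.1 x.2} := by
  classical
  choose v f hv hf hvf using exists_vec_form (F := F) (n := n)
  have hv0 : ∀ A, v A ≠ 0 := fun A h => hvf A (by rw [h, map_zero])
  have hf0 : ∀ A, f A ≠ 0 := fun A h => hvf A (by rw [h, LinearMap.zero_apply])
  have hpt : ∀ (A : AntiFlag F n) (a : Fˣ), A.pt = F ∙ ((a : F) • v A) := fun A a => by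
    rw [hv, Submodule.span_singleton_smul_eq a.isUnit]
  have hhyp : ∀ (A : AntiFlag F n) (b : Fˣ), A.hyp = LinearMap.ker ((b : F) • f A) :=
    fun A b => by rw [hf, LinearMap.ker_smul _ _ b.ne_zero]
  let Φ : S × Fˣ × Fˣ → {x : (Fin n → F) × Dual F (Fin n → F) // x.2 x.1 ≠ 0 ∧ P x.1 x.2} :=
    fun x => ⟨((x.2.1 : F) • v x.1, (x.2.2 : F) • f x.1),
      by simpa using hvf x.1,
      (hS x.1 _ _ (hpt _ _) (hhyp _ _)).1 x.1.2⟩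
  have hΦ : Function.Bijective Φ := by
    constructor
    · rintro ⟨⟨A, hA⟩, a, b⟩ ⟨⟨B, hB⟩, c, d⟩ h
      simp only [Φ, Subtype.mk.injEq, Prod.mk.injEq] at h
      obtain ⟨h1, h2⟩ := h
      have hAB : A = B := ext' (by rw [hpt A a, hpt B c, h1]) (by rw [hhyp A b, hhyp B d, h2])
      subst hAB
      simp only [Prod.mk.injEq, true_and]
      exact ⟨Units.ext (smul_left_injective F (hv0 A) h1),
        Units.ext (smul_left_injective F (hf0 A) h2)⟩
    · rintro ⟨⟨u, g⟩, hgu, hP⟩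
      let A := ofVecForm u g hgu
      have hA : A ∈ S := (hS A u g rfl rfl).2 hP
      have hu : u ∈ F ∙ v A := by
        rw [← hv A]; exact Submodule.mem_span_singleton_self u
      obtain ⟨a, ha⟩ := Submodule.mem_span_singleton.1 hu
      have hker : LinearMap.ker (f A) = LinearMap.ker g := (hf A).symm
      have hg : (g (v A) / f A (v A)) • f A = g := by
        ext1 i
        refine LinearMap.ext fun y => ?_
        set x := LinearMap.single F (fun _ => F) i y
        have hx : x - (f A x / f A (v A)) • v A ∈ LinearMap.ker (f A) := by
          simp [hvf A]
        rw [hker, LinearMap.mem_ker, map_sub, sub_eq_zero, map_smul] at hx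
        change (g (v A) / f A (v A)) • f A x = g x
        rw [hx, smul_eq_mul, smul_eq_mul]
        ring
      have ha0 : a ≠ 0 := by
        rintro rfl
        exact hgu (by rw [← ha]; simp)
      have hb0 : g (v A) / f A (v A) ≠ 0 := fun h => hgu (by rw [← hg, h]; simp)
      exact ⟨⟨⟨A, hA⟩, Units.mk0 a ha0, Units.mk0 _ hb0⟩, Subtype.ext (Prod.ext ha hg)⟩
  rw [← Nat.card_eq_of_bijective Φ hΦ, Nat.card_prod, Nat.card_prod,
    Nat.card_eq_fintype_card (α := Fˣ), Fintype.card_units, Nat.card_coe_set_eq, sq]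

end AntiFlag

section Counting

open Module

theorem sum_comp_surjective {K E E' : Type*} [Field K] [Fintype K] [AddCommGroup E] [Module K E]
    [AddCommGroup E'] [Module K E'] [Fintype E] [Fintype E'] (L : E →ₗ[K] E')
    (hL : Function.Surjective L) (g : E' → ℤ) :
    ∑ x, g (L x) = (Fintype.card K : ℤ) ^ (finrank K E - finrank K E') * ∑ y, g y := by
  classical
  have hker : Nat.card (LinearMap.ker L) =
      Fintype.card K ^ (finrank K E - finrank K E') := by
    rw [Module.natCard_eq_pow_finrank (K := K), Nat.card_eq_fintype_card]
    have := LinearMap.finrank_range_add_finrank_ker L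
    rw [LinearMap.range_eq_top.2 hL, finrank_top] at this
    congr 1
    omega
  rw [← Finset.sum_fiberwise (s := Finset.univ) (g := L), Finset.mul_sum]
  refine Finset.sum_congr rfl fun y _ => ?_
  obtain ⟨x₀, rfl⟩ := hL y
  rw [Finset.sum_congr rfl (g := fun _ => g (L x₀)) (by simp +contextual), Finset.sum_const,
    nsmul_eq_mul, ← Nat.cast_pow, ← hker]
  congr 2
  rw [Nat.card_eq_fintype_card, Fintype.card_subtype]
  refine Finset.card_bij' (fun x _ => x - x₀) (fun x _ => x + x₀) ?_ ?_ ?_ ?_ <;>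
    simp +contextual

variable {K V : Type*} [Field K] [AddCommGroup V] [Module K V]

theorem LinearIndependent.exists_dual_apply_eq {ι : Type*} {b : ι → V}
    (hb : LinearIndependent K b) (t : ι → K) : ∃ f : Dual K V, ∀ i, f (b i) = t i := by
  obtain ⟨g, hg⟩ := (Finsupp.linearCombination K b).exists_leftInverse_of_injective
    (LinearMap.ker_eq_bot.2 hb)
  refine ⟨Finsupp.linearCombination K t ∘ₗ g, fun i => ?_⟩
  have := LinearMap.congr_fun hg (Finsupp.single i 1)
  simp at this
  simp [this]

/-- The indicator of nonzero elements. -/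
noncomputable def nonzeroInd (x : K) : ℤ := by
  classical exact if x = 0 then 0 else 1

/-- The indicator of the pairs with exactly one zero entry. -/
noncomputable def xorInd (x y : K) : ℤ := by
  classical exact if (x = 0 ↔ y = 0) then 0 else 1

variable [Fintype K]

theorem sum_nonzeroInd : ∑ x : K, nonzeroInd x = (Fintype.card K : ℤ) - 1 := by
  classical
  have h : ∀ x : K, nonzeroInd x = 1 - if x = 0 then 1 else 0 := by
    intro x; unfold nonzeroInd; split_ifs <;> rfl
  simp [h]

theorem sum_xorInd (s : K) :
    ∑ y, xorInd s y = 1 + ((Fintype.card K : ℤ) - 2) * (1 - nonzeroInd s) := by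
  classical
  by_cases hs : s = 0
  · have h : ∀ y, xorInd s y = nonzeroInd y := by
      intro y; by_cases hy : y = 0 <;> simp [xorInd, nonzeroInd, hs, hy]
    simp only [h, sum_nonzeroInd]
    simp [nonzeroInd, hs]; ring
  · have h : ∀ y, xorInd s y = if y = 0 then 1 else 0 := by
      intro y; by_cases hy : y = 0 <;> simp [xorInd, hs, hy]
    simp [h, nonzeroInd, hs]

theorem sum_sum_xorInd : ∑ s : K, ∑ y, xorInd s y = 2 * ((Fintype.card K : ℤ) - 1) := by
  simp only [sum_xorInd, Finset.sum_add_distrib, ← Finset.mul_sum, Finset.sum_sub_distrib,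
    sum_nonzeroInd]
  simp; ring

theorem sum_form_eq_of_linearIndependent [Fintype (Dual K V)] {v v1 v2 : V}
    (h : LinearIndependent K ![v, v1, v2]) (x y : K) :
    ∑ f : Dual K V, nonzeroInd (f v) * (xorInd x (f v1) * xorInd y (f v2)) =
      (Fintype.card K : ℤ) ^ (finrank K V - 3) * (((Fintype.card K : ℤ) - 1) *
        ((∑ t, xorInd x t) * ∑ t, xorInd y t)) := by
  let L : Dual K V →ₗ[K] K × K × K :=
    (LinearMap.applyₗ v).prod ((LinearMap.applyₗ v1).prod (LinearMap.applyₗ v2))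
  have hL : Function.Surjective L := by
    rintro ⟨a, b, c⟩
    obtain ⟨f, hf⟩ := h.exists_dual_apply_eq ![a, b, c]
    exact ⟨f, Prod.ext (hf 0) (Prod.ext (hf 1) (hf 2))⟩
  have := sum_comp_surjective L hL
    (fun t => nonzeroInd t.1 * (xorInd x t.2.1 * xorInd y t.2.2))
  rw [Subspace.dual_finrank_eq] at this
  simp only [finrank_prod, finrank_self] at this
  refine this.trans ?_
  congr 1
  simp only [Fintype.sum_prod_type, ← Finset.mul_sum, ← Finset.sum_mul, sum_nonzeroInd]

theorem sum_form_eq_of_mem_span [Fintype (Dual K V)] {v1 v2 : V}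
    (h : LinearIndependent K ![v1, v2]) (a b x y : K) :
    ∑ f : Dual K V, nonzeroInd (f (a • v1 + b • v2)) * (xorInd x (f v1) * xorInd y (f v2)) =
      (Fintype.card K : ℤ) ^ (finrank K V - 2) *
        ∑ t : K × K, nonzeroInd (a * t.1 + b * t.2) * (xorInd x t.1 * xorInd y t.2) := by
  let L : Dual K V →ₗ[K] K × K := (LinearMap.applyₗ v1).prod (LinearMap.applyₗ v2)
  have hL : Function.Surjective L := by
    rintro ⟨a, b⟩
    obtain ⟨f, hf⟩ := h.exists_dual_apply_eq ![a, b]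
    exact ⟨f, Prod.ext (hf 0) (hf 1)⟩
  have := sum_comp_surjective L hL
    (fun t => nonzeroInd (a * t.1 + b * t.2) * (xorInd x t.1 * xorInd y t.2))
  rw [Subspace.dual_finrank_eq] at this
  simp only [finrank_prod, finrank_self] at this
  rw [← this]
  simp [L]

theorem sum_vec_form_eq [Fintype V] [Fintype (Dual K V)] {v1 v2 : V} {h1 h2 : Dual K V}
    (hv : LinearIndependent K ![v1, v2])
    (hh : Function.Surjective fun v => (h1 v, h2 v)) {c : K}
    (h11 : h1 v1 = 1) (h12 : h1 v2 = 1) (h21 : h2 v1 = c) (h22 : h2 v2 = 1) :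
    ∑ v : V, ∑ f : Dual K V,
        nonzeroInd (f v) * (xorInd (h1 v) (f v1) * xorInd (h2 v) (f v2)) =
      (Fintype.card K : ℤ) ^ (finrank K V - 3) * ((Fintype.card K : ℤ) - 1) *
        ((Fintype.card K : ℤ) ^ (finrank K V - 2) * (2 * ((Fintype.card K : ℤ) - 1)) ^ 2 -
          ∑ a : K, ∑ b : K, (∑ t, xorInd (a + b) t) * ∑ t, xorInd (c * a + b) t) +
      (Fintype.card K : ℤ) ^ (finrank K V - 2) *
        ∑ a : K, ∑ b : K, ∑ y : K, ∑ z : K,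
          nonzeroInd (a * y + b * z) * (xorInd (a + b) y * xorInd (c * a + b) z) := by
  classical
  set q : ℤ := (Fintype.card K : ℤ)
  set N : V → ℤ := fun v => ∑ f : Dual K V,
        nonzeroInd (f v) * (xorInd (h1 v) (f v1) * xorInd (h2 v) (f v2)) with hN
  set G : V → ℤ := fun v => q ^ (finrank K V - 3) * ((q - 1) *
        ((∑ t, xorInd (h1 v) t) * ∑ t, xorInd (h2 v) t)) with hG
  let ι : K × K → V := fun t => t.1 • v1 + t.2 • v2
  have hι : Function.Injective ι := by
    rintro ⟨a, b⟩ ⟨a', b'⟩ h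
    have h0 : (a - a') • v1 + (b - b') • v2 = 0 := by
      rw [sub_smul, sub_smul]
      have : a • v1 + b • v2 = a' • v1 + b' • v2 := h
      rw [show a • v1 - a' • v1 + (b • v2 - b' • v2)
        = (a • v1 + b • v2) - (a' • v1 + b' • v2) by abel, this, sub_self]
    obtain ⟨ha, hb⟩ := LinearIndependent.pair_iff.1 hv _ _ h0
    exact Prod.ext (sub_eq_zero.1 ha) (sub_eq_zero.1 hb)
  have hout : ∀ v ∉ Set.range ι, N v - G v = 0 := by
    intro v hvr
    rw [sub_eq_zero]
    refine sum_form_eq_of_linearIndependent ?_ _ _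
    refine linearIndependent_finCons.2 ⟨hv, fun hmem => hvr ?_⟩
    rw [Matrix.range_cons, Matrix.range_cons, Matrix.range_empty, Set.union_empty,
      Set.singleton_union, Submodule.mem_span_pair] at hmem
    obtain ⟨a, b, h⟩ := hmem
    exact ⟨(a, b), h⟩
  have hsum : ∑ t : K × K, (N (ι t) - G (ι t)) = ∑ v, (N v - G v) :=
    Fintype.sum_of_injective ι hι _ _ hout fun _ => rfl
  have hNι : ∀ t : K × K, N (ι t) = q ^ (finrank K V - 2) * ∑ y : K, ∑ z : K,
      nonzeroInd (t.1 * y + t.2 * z) *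
        (xorInd (t.1 + t.2) y * xorInd (c * t.1 + t.2) z) := by
    rintro ⟨a, b⟩
    rw [hN]
    simp only [ι]
    rw [sum_form_eq_of_mem_span hv, Fintype.sum_prod_type]
    simp [h11, h12, h21, h22, mul_comm, q]
  have hGι : ∀ t : K × K, G (ι t) = q ^ (finrank K V - 3) * ((q - 1) *
        ((∑ s, xorInd (t.1 + t.2) s) * ∑ s, xorInd (c * t.1 + t.2) s)) := by
    rintro ⟨a, b⟩
    simp [hG, ι, h11, h12, h21, h22, mul_comm]
  have hGsum : ∑ v, G v = q ^ (finrank K V - 3) * ((q - 1) *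
      (q ^ (finrank K V - 2) * (2 * (q - 1)) ^ 2)) := by
    have := sum_comp_surjective (h1.prod h2) hh
      (fun s => (∑ t, xorInd s.1 t) * ∑ t, xorInd s.2 t)
    simp only [finrank_prod, finrank_self, Fintype.sum_prod_type, ← Finset.mul_sum,
      ← Finset.sum_mul, sum_sum_xorInd] at this
    rw [sq]
    simp only [hG, ← Finset.mul_sum]
    congr 2
  rw [Finset.sum_sub_distrib, Finset.sum_sub_distrib, hGsum] at hsum
  simp only [hNι, hGι, ← Finset.mul_sum, Fintype.sum_prod_type] at hsum
  linear_combination -hsum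

theorem xorInd_zero_left {K : Type*} [Field K] (y : K) : xorInd 0 y = nonzeroInd y := by
  by_cases hy : y = 0 <;> simp [xorInd, nonzeroInd, hy]

open Classical in
theorem xorInd_of_left_ne_zero {K : Type*} [Field K] {s : K} (hs : s ≠ 0) (y : K) :
    xorInd s y = if y = 0 then 1 else 0 := by
  by_cases hy : y = 0 <;> simp [xorInd, hs, hy]

theorem nonzeroInd_zero {K : Type*} [Field K] : nonzeroInd (0 : K) = 0 := by
  simp [nonzeroInd]

theorem nonzeroInd_of_ne_zero {K : Type*} [Field K] {x : K} (hx : x ≠ 0) :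
    nonzeroInd x = 1 := by
  simp [nonzeroInd, hx]

theorem nonzeroInd_mul {K : Type*} [Field K] (x y : K) :
    nonzeroInd (x * y) = nonzeroInd x * nonzeroInd y := by
  by_cases hx : x = 0 <;> by_cases hy : y = 0 <;> simp [nonzeroInd, hx, hy]

theorem nonzeroInd_mul_self {K : Type*} [Field K] (x : K) :
    nonzeroInd x * nonzeroInd x = nonzeroInd x := by
  by_cases hx : x = 0 <;> simp [nonzeroInd, hx]

theorem sum_plane_change {c : K} (hc : c ≠ 1) (g : K → K → ℤ) :
    ∑ a : K, ∑ b : K, g (a + b) (c * a + b) = ∑ s : K, ∑ t : K, g s t := by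
  let L : K × K →ₗ[K] K × K :=
    (LinearMap.fst K K K + LinearMap.snd K K K).prod
      (c • LinearMap.fst K K K + LinearMap.snd K K K)
  have hc' : 1 - c ≠ 0 := sub_ne_zero.2 hc.symm
  have hL : Function.Surjective L := by
    rintro ⟨s, t⟩
    refine ⟨((s - t) / (1 - c), s - (s - t) / (1 - c)), Prod.ext ?_ ?_⟩
    · simp [L]
    · simp [L]; field_simp; ring
  have := sum_comp_surjective L hL (fun x => g x.1 x.2)
  simpa [L, Fintype.sum_prod_type] using this

theorem sum_plane_of_ne_one {c : K} (hc : c ≠ 1) :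
    ∑ a : K, ∑ b : K, (∑ t, xorInd (a + b) t) * ∑ t, xorInd (c * a + b) t =
      (2 * ((Fintype.card K : ℤ) - 1)) ^ 2 := by
  rw [sum_plane_change hc (fun s u => (∑ t, xorInd s t) * ∑ t, xorInd u t)]
  simp only [← Finset.mul_sum, ← Finset.sum_mul, sum_sum_xorInd]
  ring

theorem sum_pairing_of_ne_one {c : K} (hc0 : c ≠ 0) (hc : c ≠ 1) (a b : K) :
    ∑ y : K, ∑ z : K,
      nonzeroInd (a * y + b * z) * (xorInd (a + b) y * xorInd (c * a + b) z) =
      ((Fintype.card K : ℤ) - 1) * xorInd (a + b) (c * a + b) := by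
  classical
  by_cases hs : a + b = 0 <;> by_cases ht : c * a + b = 0
  · have ha : a = 0 := by
      have : (c - 1) * a = 0 := by linear_combination ht - hs
      exact (mul_eq_zero.1 this).resolve_left (sub_ne_zero.2 hc)
    have hb : b = 0 := by simpa [ha] using hs
    simp [ha, hb, nonzeroInd_zero, xorInd_zero_left]
  · have ha : a ≠ 0 := by
      rintro rfl
      exact ht (by simpa using hs)
    simp only [hs, xorInd_zero_left, xorInd_of_left_ne_zero ht]
    simp [nonzeroInd_mul, nonzeroInd_of_ne_zero ha, nonzeroInd_mul_self, sum_nonzeroInd,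
      nonzeroInd_of_ne_zero ht]
  · have hb : b ≠ 0 := by
      rintro rfl
      have ha : a ≠ 0 := by simpa using hs
      exact hc0 (by simpa [ha] using ht)
    rw [Finset.sum_comm]
    simp only [ht, xorInd_zero_left, xorInd_of_left_ne_zero hs]
    simp [nonzeroInd_mul, nonzeroInd_of_ne_zero hb, nonzeroInd_mul_self, sum_nonzeroInd]
  · simp [xorInd_of_left_ne_zero hs, xorInd_of_left_ne_zero ht, ht, nonzeroInd_zero]

theorem sum_plane_pairing_of_ne_one {c : K} (hc0 : c ≠ 0) (hc : c ≠ 1) :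
    ∑ a : K, ∑ b : K, ∑ y : K, ∑ z : K,
      nonzeroInd (a * y + b * z) * (xorInd (a + b) y * xorInd (c * a + b) z) =
      2 * ((Fintype.card K : ℤ) - 1) ^ 2 := by
  simp only [sum_pairing_of_ne_one hc0 hc]
  rw [sum_plane_change hc (fun s t => ((Fintype.card K : ℤ) - 1) * xorInd s t)]
  simp only [← Finset.mul_sum, sum_sum_xorInd]
  ring

theorem sum_plane_one :
    ∑ a : K, ∑ b : K, (∑ t, xorInd (a + b) t) * ∑ t, xorInd (1 * a + b) t =
      (Fintype.card K : ℤ) ^ 2 * ((Fintype.card K : ℤ) - 1) := by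
  have h : ∀ a : K, ∑ b : K, (∑ t, xorInd (a + b) t) * ∑ t, xorInd (1 * a + b) t =
      (Fintype.card K : ℤ) * ((Fintype.card K : ℤ) - 1) := by
    intro a
    simp only [one_mul]
    rw [Fintype.sum_equiv (Equiv.addLeft a)
      (fun b => (∑ t, xorInd (a + b) t) * ∑ t, xorInd (a + b) t)
      (fun s => (∑ t, xorInd s t) * ∑ t, xorInd s t) (fun _ => rfl)]
    have he : ∀ s : K, (∑ t, xorInd s t) * ∑ t, xorInd s t =
        1 + (Fintype.card K : ℤ) * ((Fintype.card K : ℤ) - 2) * (1 - nonzeroInd s) := by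
      intro s
      rw [sum_xorInd]
      linear_combination ((Fintype.card K : ℤ) - 2) ^ 2 * nonzeroInd_mul_self s
    simp only [he, Finset.sum_add_distrib, ← Finset.mul_sum, Finset.sum_sub_distrib,
      sum_nonzeroInd]
    simp
    ring
  simp only [h]
  simp
  ring

theorem sum_nonzeroInd_sub_mul (y : K) :
    nonzeroInd y * ∑ z : K, nonzeroInd (y - z) * nonzeroInd z =
      nonzeroInd y * ((Fintype.card K : ℤ) - 2) := by
  classical
  by_cases hy : y = 0
  · simp [hy, nonzeroInd_zero]
  have h : ∀ z : K, nonzeroInd (y - z) * nonzeroInd z =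
      1 - (if y = z then 1 else 0) - (if z = 0 then 1 else 0) := by
    intro z
    by_cases hz : z = 0 <;> by_cases hyz : y = z <;>
      simp_all [nonzeroInd, sub_eq_zero]
  simp [h]
  left
  ring

theorem sum_plane_pairing_one :
    ∑ a : K, ∑ b : K, ∑ y : K, ∑ z : K,
      nonzeroInd (a * y + b * z) * (xorInd (a + b) y * xorInd (1 * a + b) z) =
      ((Fintype.card K : ℤ) - 1) ^ 2 * ((Fintype.card K : ℤ) - 2) := by
  classical
  have h : ∀ a b : K, ∑ y : K, ∑ z : K,
      nonzeroInd (a * y + b * z) * (xorInd (a + b) y * xorInd (1 * a + b) z) =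
      if b = -a then nonzeroInd a * (((Fintype.card K : ℤ) - 1) * ((Fintype.card K : ℤ) - 2))
      else 0 := by
    intro a b
    rw [one_mul]
    split_ifs with hb
    · subst hb
      have hyz : ∀ y z : K, nonzeroInd (a * y + -a * z) * (xorInd (a + -a) y * xorInd (a + -a) z) =
          nonzeroInd a * (nonzeroInd y * (nonzeroInd (y - z) * nonzeroInd z)) := by
        intro y z
        rw [add_neg_cancel, xorInd_zero_left, xorInd_zero_left,
          show a * y + -a * z = a * (y - z) by ring, nonzeroInd_mul]
        ring
      simp only [hyz, ← Finset.mul_sum, sum_nonzeroInd_sub_mul, ← Finset.sum_mul, sum_nonzeroInd]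
    · have hs : a + b ≠ 0 := fun h => hb (eq_neg_of_add_eq_zero_right h)
      simp [xorInd_of_left_ne_zero hs, nonzeroInd_zero]
  simp only [h, Finset.sum_ite_eq', Finset.mem_univ, if_true, ← Finset.sum_mul, sum_nonzeroInd]
  ring

end Counting

section Main

open Module

theorem adj1_iff (A B : AntiFlag F n) : adj1 A B ↔ ¬ (B.pt ≤ A.hyp ↔ A.pt ≤ B.hyp) := by
  have h : ¬ (B.pt ≤ A.hyp ↔ A.pt ≤ B.hyp) → A ≠ B := by
    rintro h rfl
    exact h Iff.rfl
  unfold adj1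
  tauto

theorem adj4.exists_normalized {A B : AntiFlag F n} (h : adj4 A B) :
    ∃ (v1 v2 : Fin n → F) (h1 h2 : Dual F (Fin n → F)),
      A.pt = F ∙ v1 ∧ B.pt = F ∙ v2 ∧ A.hyp = LinearMap.ker h1 ∧ B.hyp = LinearMap.ker h2 ∧
      h1 v1 = 1 ∧ h1 v2 = 1 ∧ h2 v2 = 1 ∧ h2 v1 ≠ 0 := by
  obtain ⟨v1, f1, hv1, hf1, h11⟩ := A.exists_vec_form
  obtain ⟨v2, f2, hv2, hf2, h22⟩ := B.exists_vec_form
  obtain ⟨-, -, -, hAB, hBA⟩ := h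
  rw [AntiFlag.pt_le_hyp_iff hv1 hf2] at hAB
  rw [AntiFlag.pt_le_hyp_iff hv2 hf1] at hBA
  have ha : f1 v1 / f1 v2 ≠ 0 := div_ne_zero h11 hBA
  have hb : (f2 ((f1 v1 / f1 v2) • v2))⁻¹ ≠ 0 := by
    simp [h11, hBA, h22]
  refine ⟨v1, (f1 v1 / f1 v2) • v2, (f1 v1)⁻¹ • f1, (f2 ((f1 v1 / f1 v2) • v2))⁻¹ • f2,
    hv1, ?_, ?_, ?_, ?_, ?_, ?_, ?_⟩
  · rw [hv2, Submodule.span_singleton_smul_eq (IsUnit.mk0 _ ha)]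
  · rw [hf1, LinearMap.ker_smul _ _ (inv_ne_zero h11)]
  · rw [hf2, LinearMap.ker_smul _ _ hb]
  · simp [h11]
  · simp
    field_simp
  · rw [LinearMap.smul_apply, smul_eq_mul, inv_mul_cancel₀ (fun h0 => hb (by rw [h0, inv_zero]))]
  · rw [LinearMap.smul_apply, smul_eq_mul]
    exact mul_ne_zero hb hAB

theorem span_inf_ker_ne_bot_iff {K V : Type*} [Field K] [AddCommGroup V] [Module K V]
    {v1 v2 : V} {h1 h2 : Dual K V} (hv : v1 ≠ v2)
    (h11 : h1 v1 = 1) (h12 : h1 v2 = 1) (h22 : h2 v2 = 1) :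
    ((K ∙ v1) ⊔ (K ∙ v2)) ⊓ (LinearMap.ker h1 ⊓ LinearMap.ker h2) ≠ ⊥ ↔ h2 v1 = 1 := by
  rw [← Submodule.span_union, Set.singleton_union, Submodule.ne_bot_iff]
  constructor
  · rintro ⟨x, ⟨hx, hx1, hx2⟩, hx0⟩
    obtain ⟨a, b, rfl⟩ := Submodule.mem_span_pair.1 hx
    simp [h11, h12] at hx1
    simp [h22] at hx2
    by_contra hc
    have : a * (h2 v1 - 1) = 0 := by linear_combination hx2 - hx1
    have ha : a = 0 := (mul_eq_zero.1 this).resolve_right (sub_ne_zero.2 hc)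
    have hb : b = 0 := by simpa [ha] using hx1
    exact hx0 (by simp [ha, hb])
  · intro hc
    refine ⟨v1 - v2, ⟨?_, ?_, ?_⟩, sub_ne_zero.2 hv⟩
    · exact sub_mem (Submodule.subset_span (by simp)) (Submodule.subset_span (by simp))
    · simp [h11, h12]
    · simp [hc, h22]

theorem ncard_perpSet_mul [Fintype F] {A B : AntiFlag F n} {v1 v2 : Fin n → F}
    {h1 h2 : Dual F (Fin n → F)} [Fintype (Dual F (Fin n → F))]
    (hA : A.pt = F ∙ v1) (hB : B.pt = F ∙ v2)
    (hA' : A.hyp = LinearMap.ker h1) (hB' : B.hyp = LinearMap.ker h2) :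
    ((perpSet adj1 {A, B}).ncard : ℤ) * ((Fintype.card F : ℤ) - 1) ^ 2 =
      ∑ v : Fin n → F, ∑ f : Dual F (Fin n → F),
        nonzeroInd (f v) * (xorInd (h1 v) (f v1) * xorInd (h2 v) (f v2)) := by
  classical
  have := AntiFlag.card_mul_sq
    (fun v f => ¬ (h1 v = 0 ↔ f v1 = 0) ∧ ¬ (h2 v = 0 ↔ f v2 = 0)) (perpSet adj1 {A, B})
    (by
      intro C v f hv hf
      simp only [perpSet, Set.mem_ofPred_eq, Set.mem_insert_iff, Set.mem_singleton_iff,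
        forall_eq_or_imp, forall_eq, adj1_iff, AntiFlag.pt_le_hyp_iff hv hA',
        AntiFlag.pt_le_hyp_iff hv hB', AntiFlag.pt_le_hyp_iff hA hf,
        AntiFlag.pt_le_hyp_iff hB hf])
  rw [Nat.card_eq_fintype_card, Fintype.card_subtype, Finset.card_filter,
    Fintype.sum_prod_type] at this
  have hq : 1 ≤ Fintype.card F := Fintype.card_pos
  zify [hq] at this
  rw [this]
  refine Finset.sum_congr rfl fun v _ => Finset.sum_congr rfl fun f _ => ?_
  unfold nonzeroInd xorInd
  split_ifs <;> simp_all

theorem adj4.surjective_forms {A B : AntiFlag F n} (h : adj4 A B) {v1 : Fin n → F}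
    {h1 h2 : Dual F (Fin n → F)} (hA : A.hyp = LinearMap.ker h1) (hB : B.hyp = LinearMap.ker h2)
    (h11 : h1 v1 = 1) : Function.Surjective fun v => (h1 v, h2 v) := by
  obtain ⟨u, hu1, hu2⟩ : ∃ u, h1 u = 0 ∧ h2 u ≠ 0 := by
    by_contra! hu
    refine h.2.2.1 (Submodule.eq_of_le_of_finrank_le ?_ (by rw [A.hyp_rank, B.hyp_rank]))
    rw [hA, hB]
    exact hu
  rintro ⟨x, y⟩
  refine ⟨x • v1 + ((y - x * h2 v1) / h2 u) • u, Prod.ext ?_ ?_⟩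
  · simp [h11, hu1]
  · simp
    field_simp
    ring

theorem adj4.linearIndependent {A B : AntiFlag F n} (h : adj4 A B) {v1 v2 : Fin n → F}
    {h1 : Dual F (Fin n → F)} (hA : A.pt = F ∙ v1) (hB : B.pt = F ∙ v2)
    (h11 : h1 v1 = 1) (h12 : h1 v2 = 1) : LinearIndependent F ![v1, v2] := by
  rw [LinearIndependent.pair_iff]
  intro a b hab
  have hs : a + b = 0 := by simpa [h11, h12] using congrArg h1 hab
  obtain rfl : b = -a := eq_neg_of_add_eq_zero_right hs
  have hv : v1 - v2 ≠ 0 := sub_ne_zero.2 fun hv => h.2.1 (by rw [hA, hB, hv])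
  have ha : a • (v1 - v2) = 0 := by rw [← hab, smul_sub, neg_smul, sub_eq_add_neg]
  have := (smul_eq_zero.1 ha).resolve_right hv
  simp [this]

end Main

theorem stmt15 [Fintype F] {q : ℕ} (hq : Fintype.card F = q) (hn : 3 ≤ n)
    (A1 A2 : AntiFlag F n) (h4 : adj4 A1 A2) :
    ((A1.pt ⊔ A2.pt) ⊓ (A1.hyp ⊓ A2.hyp) ≠ ⊥ →
      (perpSet adj1 {A1, A2}).ncard =
        4 * q ^ (n - 2) * (q ^ (n - 2) - q ^ (n - 3)) - 2 * q ^ (n - 2)) ∧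
    ((A1.pt ⊔ A2.pt) ⊓ (A1.hyp ⊓ A2.hyp) = ⊥ →
      (perpSet adj1 {A1, A2}).ncard =
        4 * (q ^ (n - 2) - 1) * (q - 1) * q ^ (n - 3) + 2 * q ^ (n - 2)) := by
  classical
  have : Fintype (Module.Dual F (Fin n → F)) := @Fintype.ofFinite _ (Module.finite_of_finite F)
  subst hq
  obtain ⟨v1, v2, h1, h2, hA, hB, hA', hB', h11, h12, h22, hc0⟩ := h4.exists_normalized
  have hv := h4.linearIndependent hA hB h11 h12
  have hne : v1 ≠ v2 := fun hv => h4.2.1 (by rw [hA, hB, hv])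
  have key := sum_vec_form_eq hv (h4.surjective_forms hA' hB' h11) h11 h12 rfl h22
  rw [← ncard_perpSet_mul hA hB hA' hB', Module.finrank_fin_fun] at key
  have hmeet := span_inf_ker_ne_bot_iff hne h11 h12 h22
  rw [← hA, ← hB, ← hA', ← hB'] at hmeet
  have hq1 : 1 < Fintype.card F := Fintype.one_lt_card
  obtain ⟨m, rfl⟩ := Nat.exists_eq_add_of_le' hn
  simp only [show m + 3 - 2 = m + 1 by omega, Nat.add_sub_cancel] at key ⊢
  set q := Fintype.card F with hq
  have hq2 : ((q : ℤ) - 1) ^ 2 ≠ 0 := pow_ne_zero _ (by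
    have : (1 : ℤ) < q := by exact_mod_cast hq1
    omega)
  have hpow : 1 ≤ q ^ m := Nat.one_le_pow _ _ (by omega)
  refine ⟨fun h => ?_, fun h => ?_⟩
  · rw [hmeet.1 h, sum_plane_one, sum_plane_pairing_one, ← hq] at key
    have hsub : q ^ (m + 1) - q ^ m = q ^ m * (q - 1) := by
      rw [pow_succ, Nat.mul_sub, mul_one]
    have hle : 2 * q ^ (m + 1) ≤ 4 * q ^ (m + 1) * (q ^ m * (q - 1)) := by
      have : 1 ≤ q ^ m * (q - 1) := Nat.mul_pos hpow (by omega)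
      nlinarith [Nat.zero_le (q ^ (m + 1))]
    rw [hsub]
    zify [hle, hq1.le]
    refine mul_right_cancel₀ hq2 ?_
    rw [key]
    ring
  · have hc : h2 v1 ≠ 1 := fun hc => hmeet.2 hc h
    rw [sum_plane_of_ne_one hc, sum_plane_pairing_of_ne_one hc0 hc, ← hq] at key
    have hpow' : 1 ≤ q ^ (m + 1) := Nat.one_le_pow _ _ (by omega)
    zify [hpow', hq1.le]
    refine mul_right_cancel₀ hq2 ?_
    rw [key]
    ring
end
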